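/- arXiv:1311.7378 — 2 statements merged into one kernel-verified Lean document; each statement's English description precedes it below -/
import Mathlib

section
/- Let H₁, H₂, H₃ be nonzero finite-dimensional complex inner product spaces with dim H₂ ≥ 2. Let A be a self-adjoint operator on H₁ ⊗ H₂ and B a self-adjoint operator on H₂ ⊗ H₃, and assume that the operators A ⊗ I_{H₃} and I_{H₁} ⊗ B on H₁ ⊗ H₂ ⊗ H₃ commute (after the evident reassociation of tensor factors). Then there exist a finite index set 𝒜, pairwise orthogonal nonzero subspaces {V_α}_{α∈𝒜} of H₂ whose direct sum is all of H₂, and for each α nonzero finite-dimensional complex inner product spaces V_α^A, V_α^B together with a unitary isomorphism u_α : V_α ≅ V_α^A ⊗ V_α^B, such that: (i) A maps H₁ ⊗ V_α into itself and B maps V_α ⊗ H₃ into itself; (ii) the restriction of A to H₁ ⊗ V_α, conjugated by I_{H₁} ⊗ u_α, equals a_α ⊗ I_{V_α^B} for some operator a_α on H₁ ⊗ V_α^A; (iii) the restriction of B to V_α ⊗ H₃, conjugated by u_α ⊗ I_{H₃}, equals I_{V_α^A} ⊗ b_α for some operator b_α on V_α^B ⊗ H₃. Moreover, if A is not of the form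 a ⊗ I_{H₂} for any operator a on H₁, and B is not of the form I_{H₂} ⊗ b for any operator b on H₃, then the decomposition can be chosen so that dim V_α^A < dim H₂ and dim V_α^B < dim H₂ for every α. -/
open Matrix Kronecker

/-- Decomposition into irreducibles. -/
theorem bv_irred (k : ℕ) : ∀ (n : Type) [Fintype n] [DecidableEq n], Fintype.card n = k →
    ∀ S : Set (Matrix n n ℂ), (∀ x ∈ S, xᴴ ∈ S) →
    ∃ (ι : Type) (_ : Fintype ι) (_ : DecidableEq ι) (d : ι → ℕ)
      (U : (i : ι) → Matrix n (Fin (d i)) ℂ),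
      (∀ i, 1 ≤ d i) ∧ (∀ i, (U i)ᴴ * U i = 1) ∧ (∀ i j, i ≠ j → (U i)ᴴ * U j = 0) ∧
      (∑ i, U i * (U i)ᴴ = 1) ∧ (∀ i j, i ≠ j → ∀ x ∈ S, (U i)ᴴ * x * U j = 0) ∧
      (∀ i, ∀ T : Matrix (Fin (d i)) (Fin (d i)) ℂ,
        (∀ x ∈ S, Commute ((U i)ᴴ * x * U i) T) → ∃ c : ℂ, T = c • 1) := by
  induction k using Nat.strong_induction_on with
  | _ k ih =>
  intro n _ _ hn S hS
  by_cases h0 : IsEmpty n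
  · refine ⟨Empty, inferInstance, inferInstance, fun _ => 0, fun i => i.elim, fun i => i.elim,
      fun i => i.elim, fun i => i.elim, ?_, fun i => i.elim, fun i => i.elim⟩
    ext i; exact h0.elim i
  rw [not_isEmpty_iff] at h0
  by_cases hirr : ∀ T : Matrix n n ℂ, T.IsHermitian → (∀ x ∈ S, Commute x T) → ∃ c : ℂ, T = c • 1
  · -- irreducible
    have hirr2 : ∀ T : Matrix n n ℂ, (∀ x ∈ S, Commute x T) → ∃ c : ℂ, T = c • 1 := by
      intro T hT
      have hT' : ∀ x ∈ S, Commute x Tᴴ := by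
        intro x hx
        have := hT _ (hS x hx)
        have h2 := congrArg conjTranspose this.eq
        simp only [conjTranspose_mul, conjTranspose_conjTranspose] at h2
        exact h2.symm
      obtain ⟨c1, h1⟩ := hirr (T + Tᴴ) (by simp [IsHermitian, add_comm])
        (fun x hx => (hT x hx).add_right (hT' x hx))
      obtain ⟨c2, h2⟩ := hirr (Complex.I • (T - Tᴴ))
        (by simp [IsHermitian, conjTranspose_smul, smul_sub]; abel)
        (fun x hx => ((hT x hx).sub_right (hT' x hx)).smul_right _)
      refine ⟨(c1 - Complex.I * c2) / 2, ?_⟩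
      have h3 : T - Tᴴ = (-Complex.I * c2) • 1 := by
        rw [mul_smul, ← h2, smul_smul]; simp
      have : T = (1/2 : ℂ) • ((T + Tᴴ) + (T - Tᴴ)) := by
        ext i j; simp; ring
      rw [this, h1, h3, ← add_smul, smul_smul]
      congr 1; ring
    let e := Fintype.equivFin n
    refine ⟨Unit, inferInstance, inferInstance, fun _ => Fintype.card n,
      fun _ => (1 : Matrix n n ℂ).submatrix id e.symm, ?_, ?_, ?_, ?_, ?_, ?_⟩
    · intro _; exact Fintype.card_pos
    · intro _
      ext i j
      simp [Matrix.mul_apply, Matrix.one_apply]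
    · intro i j h; exact absurd rfl h
    · simp only [Finset.univ_unique, Finset.sum_singleton]
      rw [conjTranspose_submatrix, conjTranspose_one, submatrix_mul_equiv]
      simp
    · intro i j h; exact absurd rfl h
    · intro _ T hT
      obtain ⟨c, hc⟩ := hirr2 (T.submatrix e e) (by
        intro x hx
        have h := hT x hx
        have hx' : ((1 : Matrix n n ℂ).submatrix id e.symm)ᴴ * x * (1 : Matrix n n ℂ).submatrix id e.symm
            = x.submatrix e.symm e.symm := by
          ext i j
          simp [Matrix.mul_apply, Matrix.one_apply]
        rw [hx'] at h
        have h2 := congrArg (fun M => M.submatrix e e) h.eq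
        simp only [← submatrix_mul_equiv (e₂ := e), submatrix_submatrix] at h2
        rw [commute_iff_eq]
        simpa using h2)
      refine ⟨c, ?_⟩
      have := congrArg (fun M => M.submatrix e.symm e.symm) hc
      rw [submatrix_smul] at this
      simpa using this
  · push Not at hirr
    obtain ⟨T, hTh, hTc, hTn⟩ := hirr
    obtain ⟨P, ev, hP1, hP2, hTD⟩ : ∃ (P : Matrix n n ℂ) (ev : n → ℝ), Pᴴ * P = 1 ∧ P * Pᴴ = 1 ∧
        T = P * diagonal (fun i => (ev i : ℂ)) * Pᴴ := by
      refine ⟨hTh.eigenvectorUnitary, hTh.eigenvalues,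
        Unitary.coe_star_mul_self hTh.eigenvectorUnitary,
        Unitary.coe_mul_star_self hTh.eigenvectorUnitary, ?_⟩
      have := hTh.spectral_theorem
      rw [Unitary.conjStarAlgAut_apply] at this
      exact this
    let D : Matrix n n ℂ := diagonal (fun i => (ev i : ℂ))
    change T = P * D * Pᴴ at hTD
    obtain ⟨i0⟩ := id h0
    let p : n → Prop := fun i => ev i = ev i0
    have hex : ∃ j, ¬ p j := by
      by_contra hcon
      push Not at hcon
      apply hTn (ev i0 : ℂ)
      have : D = (ev i0 : ℂ) • 1 := by
        rw [smul_one_eq_diagonal]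
        exact congrArg diagonal (funext fun i => by rw [hcon i])
      rw [hTD, this]; simp [hP2]
    obtain ⟨j0, hj0⟩ := hex
    classical
    have hxD : ∀ x ∈ S, ∀ i j, ev i ≠ ev j → (Pᴴ * x * P) i j = 0 := by
      intro x hx i j hij
      have h := (hTc x hx).eq
      have h2 : (Pᴴ * x * P) * D = D * (Pᴴ * x * P) := by
        have hD : D = Pᴴ * T * P := by
          rw [hTD]
          calc D = (Pᴴ * P) * D * (Pᴴ * P) := by rw [hP1]; simp
            _ = _ := by simp only [Matrix.mul_assoc]
        calc (Pᴴ * x * P) * D = Pᴴ * x * (P * Pᴴ) * T * P := by rw [hD]; simp only [Matrix.mul_assoc]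
          _ = Pᴴ * (x * T) * P := by rw [hP2]; simp only [Matrix.mul_assoc, Matrix.mul_one]
          _ = Pᴴ * T * (P * Pᴴ) * x * P := by rw [h, hP2]; simp only [Matrix.mul_assoc, Matrix.mul_one]
          _ = _ := by rw [hD]; simp only [Matrix.mul_assoc]
      have h3 := congrFun (congrFun h2 i) j
      simp only [D, mul_diagonal, diagonal_mul] at h3
      have h4 : (ev j - ev i : ℂ) ≠ 0 := by
        rw [sub_ne_zero]; exact_mod_cast hij.symm
      apply (mul_eq_zero.mp (_ : (ev j - ev i : ℂ) * (Pᴴ * x * P) i j = 0)).resolve_left h4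
      linear_combination h3
    let Q1 : Matrix n {i // p i} ℂ := P.submatrix id Subtype.val
    let Q2 : Matrix n {i // ¬ p i} ℂ := P.submatrix id Subtype.val
    have key : ∀ (x : Matrix n n ℂ) (r s : n → Prop) (i : {i // r i}) (j : {i // s i}),
        ((P.submatrix id (Subtype.val : {i // r i} → n))ᴴ * x * (P.submatrix id (Subtype.val : {i // s i} → n))) i j = (Pᴴ * x * P) i j := by
      intro x r s i j
      simp [Matrix.mul_apply]
    have key1 : ∀ (r s : n → Prop) (i : {i // r i}) (j : {i // s i}),
        ((P.submatrix id (Subtype.val : {i // r i} → n))ᴴ * (P.submatrix id (Subtype.val : {i // s i} → n))) i j = (Pᴴ * P) i j := by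
      intro r s i j
      simp [Matrix.mul_apply]
    have q11 : Q1ᴴ * Q1 = 1 := by
      ext i j; rw [key1, hP1]; simp [Matrix.one_apply, Subtype.ext_iff]
    have q22 : Q2ᴴ * Q2 = 1 := by
      ext i j; rw [key1, hP1]; simp [Matrix.one_apply, Subtype.ext_iff]
    have q12 : Q1ᴴ * Q2 = 0 := by
      ext i j; rw [key1, hP1, Matrix.one_apply_ne]; simp
      intro h; exact j.2 (h ▸ i.2)
    have q21 : Q2ᴴ * Q1 = 0 := by
      have := congrArg conjTranspose q12
      simpa using this
    have x12 : ∀ x ∈ S, Q1ᴴ * x * Q2 = 0 := by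
      intro x hx
      ext i j; rw [key, hxD x hx]; simp
      intro h; exact j.2 (h.symm.trans i.2)
    have x21 : ∀ x ∈ S, Q2ᴴ * x * Q1 = 0 := by
      intro x hx
      ext i j; rw [key, hxD x hx]; simp
      intro h; exact i.2 (h.trans j.2)
    have qs : Q1 * Q1ᴴ + Q2 * Q2ᴴ = 1 := by
      rw [← hP2]
      ext i j
      simp only [Matrix.add_apply, Matrix.mul_apply, Q1, Q2, submatrix_apply, conjTranspose_apply, id]
      exact Fintype.sum_subtype_add_sum_subtype p (fun k => P i k * star (P j k))
    have c1 : Fintype.card {i // p i} < k := hn ▸ Fintype.card_subtype_lt hj0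
    have c2 : Fintype.card {i // ¬ p i} < k := hn ▸ Fintype.card_subtype_lt (x := i0) (by simp [p])
    obtain ⟨ι1, _, _, d1, U1, a1, a2, a3, a4, a5, a6⟩ := ih _ c1 {i // p i} rfl
      (Set.image (fun x => Q1ᴴ * x * Q1) S) (by
        rintro _ ⟨x, hx, rfl⟩
        exact ⟨xᴴ, hS x hx, by simp [Matrix.mul_assoc]⟩)
    obtain ⟨ι2, _, _, d2, U2, b1, b2, b3, b4, b5, b6⟩ := ih _ c2 {i // ¬ p i} rfl
      (Set.image (fun x => Q2ᴴ * x * Q2) S) (by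
        rintro _ ⟨x, hx, rfl⟩
        exact ⟨xᴴ, hS x hx, by simp [Matrix.mul_assoc]⟩)
    have asc : ∀ {r s t u : Type} [Fintype r] [Fintype s] (Q : Matrix n r ℂ) (Q' : Matrix n s ℂ)
      (V : Matrix r t ℂ) (V' : Matrix s u ℂ), (Q * V)ᴴ * (Q' * V') = Vᴴ * (Qᴴ * Q') * V' := by
      intros; simp only [conjTranspose_mul, Matrix.mul_assoc]
    have asx : ∀ {r s t u : Type} [Fintype r] [Fintype s] (x : Matrix n n ℂ) (Q : Matrix n r ℂ) (Q' : Matrix n s ℂ)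
      (V : Matrix r t ℂ) (V' : Matrix s u ℂ), (Q * V)ᴴ * x * (Q' * V') = Vᴴ * (Qᴴ * x * Q') * V' := by
      intros; simp only [conjTranspose_mul, Matrix.mul_assoc]
    refine ⟨ι1 ⊕ ι2, inferInstance, inferInstance, Sum.elim d1 d2, fun i => match i with
      | .inl i => Q1 * U1 i
      | .inr i => Q2 * U2 i, ?_, ?_, ?_, ?_, ?_, ?_⟩
    · rintro (i | i)
      · exact a1 i
      · exact b1 i
    · rintro (i | i)
      · change (Q1 * U1 i)ᴴ * (Q1 * U1 i) = 1
        rw [asc, q11, Matrix.mul_one, a2]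
      · change (Q2 * U2 i)ᴴ * (Q2 * U2 i) = 1
        rw [asc, q22, Matrix.mul_one, b2]
    · rintro (i | i) (j | j) hij
      · change (Q1 * U1 i)ᴴ * (Q1 * U1 j) = 0
        rw [asc, q11, Matrix.mul_one, a3 i j (by simpa using hij)]
      · change (Q1 * U1 i)ᴴ * (Q2 * U2 j) = 0
        rw [asc, q12]; simp
      · change (Q2 * U2 i)ᴴ * (Q1 * U1 j) = 0
        rw [asc, q21]; simp
      · change (Q2 * U2 i)ᴴ * (Q2 * U2 j) = 0
        rw [asc, q22, Matrix.mul_one, b3 i j (by simpa using hij)]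
    · rw [Fintype.sum_sum_type]
      change ∑ i, (Q1 * U1 i) * (Q1 * U1 i)ᴴ + ∑ i, (Q2 * U2 i) * (Q2 * U2 i)ᴴ = 1
      have e1 : ∑ i, (Q1 * U1 i) * (Q1 * U1 i)ᴴ = Q1 * (∑ i, U1 i * (U1 i)ᴴ) * Q1ᴴ := by
        simp only [Matrix.mul_sum, Matrix.sum_mul, conjTranspose_mul, Matrix.mul_assoc]
      have e2 : ∑ i, (Q2 * U2 i) * (Q2 * U2 i)ᴴ = Q2 * (∑ i, U2 i * (U2 i)ᴴ) * Q2ᴴ := by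
        simp only [Matrix.mul_sum, Matrix.sum_mul, conjTranspose_mul, Matrix.mul_assoc]
      rw [e1, e2, a4, b4, Matrix.mul_one, Matrix.mul_one, qs]
    · rintro (i | i) (j | j) hij x hx
      · change (Q1 * U1 i)ᴴ * x * (Q1 * U1 j) = 0
        rw [asx, a5 i j (by simpa using hij) _ ⟨x, hx, rfl⟩]
      · change (Q1 * U1 i)ᴴ * x * (Q2 * U2 j) = 0
        rw [asx, x12 x hx]; simp
      · change (Q2 * U2 i)ᴴ * x * (Q1 * U1 j) = 0
        rw [asx, x21 x hx]; simp
      · change (Q2 * U2 i)ᴴ * x * (Q2 * U2 j) = 0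
        rw [asx, b5 i j (by simpa using hij) _ ⟨x, hx, rfl⟩]
    · rintro (i | i) T hT
      · refine a6 i T ?_
        rintro _ ⟨x, hx, rfl⟩
        have := hT x hx
        change Commute ((Q1 * U1 i)ᴴ * x * (Q1 * U1 i)) T at this
        rwa [asx] at this
      · refine b6 i T ?_
        rintro _ ⟨x, hx, rfl⟩
        have := hT x hx
        change Commute ((Q2 * U2 i)ᴴ * x * (Q2 * U2 i)) T at this
        rwa [asx] at this

theorem bv_schur {d e : ℕ} {X : Type} (S : Set X) (π : X → Matrix (Fin d) (Fin d) ℂ)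
    (ρ : X → Matrix (Fin e) (Fin e) ℂ) (st : X → X) (hst : ∀ x ∈ S, st x ∈ S)
    (hπ : ∀ x, π (st x) = (π x)ᴴ) (hρ : ∀ x, ρ (st x) = (ρ x)ᴴ)
    (iπ : ∀ T, (∀ x ∈ S, Commute (π x) T) → ∃ c : ℂ, T = c • 1)
    (iρ : ∀ T, (∀ x ∈ S, Commute (ρ x) T) → ∃ c : ℂ, T = c • 1)
    (T : Matrix (Fin d) (Fin e) ℂ) (hT : ∀ x ∈ S, π x * T = T * ρ x) (hT0 : T ≠ 0) :
    ∃ R : Matrix (Fin d) (Fin e) ℂ, R * Rᴴ = 1 ∧ Rᴴ * R = 1 ∧ ∀ x ∈ S, π x * R = R * ρ x := by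
  have hT' : ∀ x ∈ S, Tᴴ * π x = ρ x * Tᴴ := by
    intro x hx
    have := congrArg conjTranspose (hT _ (hst x hx))
    simpa [hπ, hρ] using this
  obtain ⟨c, hc⟩ := iπ (T * Tᴴ) (fun x hx => by
    rw [commute_iff_eq, ← Matrix.mul_assoc, hT x hx, Matrix.mul_assoc, Matrix.mul_assoc, hT' x hx])
  obtain ⟨c', hc'⟩ := iρ (Tᴴ * T) (fun x hx => by
    rw [commute_iff_eq, ← Matrix.mul_assoc, ← hT' x hx, Matrix.mul_assoc, Matrix.mul_assoc, hT x hx])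
  have hcc : c = c' := by
    have h : c • T = c' • T := by
      calc c • T = (T * Tᴴ) * T := by rw [hc]; simp
        _ = T * (Tᴴ * T) := Matrix.mul_assoc _ _ _
        _ = c' • T := by rw [hc']; simp
    exact smul_left_injective ℂ hT0 h
  subst hcc
  obtain ⟨i, j, hij⟩ : ∃ i j, T i j ≠ 0 := by
    by_contra hcon
    push Not at hcon
    exact hT0 (by ext i j; exact hcon i j)
  have hcv : c = ((∑ k, ‖T i k‖ ^ 2 : ℝ) : ℂ) := by
    have := congrFun (congrFun hc i) i
    simp only [Matrix.mul_apply, conjTranspose_apply, Matrix.smul_apply, one_apply_eq, smul_eq_mul, mul_one] at this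
    rw [← this]
    push_cast
    refine Finset.sum_congr rfl fun k _ => ?_
    exact Complex.mul_conj' _
  set s : ℝ := ∑ k, ‖T i k‖ ^ 2 with hs
  have hpos : 0 < s := by
    refine Finset.sum_pos' (fun k _ => by positivity) ⟨j, Finset.mem_univ _, ?_⟩
    have := norm_pos_iff.mpr hij
    positivity
  have hsq : ((Real.sqrt s)⁻¹ : ℂ) * ((Real.sqrt s)⁻¹ : ℂ) * c = 1 := by
    have h1 : (Real.sqrt s : ℂ) * (Real.sqrt s : ℂ) = s := by
      exact_mod_cast Real.mul_self_sqrt hpos.le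
    have h2 : (Real.sqrt s : ℂ) ≠ 0 := by
      exact_mod_cast (Real.sqrt_pos.mpr hpos).ne'
    rw [hcv, ← h1]; field_simp
  refine ⟨((Real.sqrt s)⁻¹ : ℂ) • T, ?_, ?_, ?_⟩
  · rw [conjTranspose_smul, smul_mul, Matrix.mul_smul, smul_smul, hc, smul_smul]
    simp [hsq]
  · rw [conjTranspose_smul, smul_mul, Matrix.mul_smul, smul_smul, hc', smul_smul]
    simp [hsq]
  · intro x hx
    rw [Matrix.mul_smul, hT x hx, smul_mul]

theorem bv_struct (n : ℕ) (S : Set (Matrix (Fin n) (Fin n) ℂ)) (hS : ∀ x ∈ S, xᴴ ∈ S) :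
    ∃ (N : ℕ) (a b : Fin N → ℕ)
      (W : (α : Fin N) → Matrix (Fin n) (Fin (a α) × Fin (b α)) ℂ),
      (∀ α, 1 ≤ a α ∧ 1 ≤ b α) ∧
      (∀ α, (W α)ᴴ * W α = 1) ∧
      (∀ α β, α ≠ β → (W α)ᴴ * W β = 0) ∧
      (∑ α, W α * (W α)ᴴ) = 1 ∧
      (∀ α β, α ≠ β → ∀ x ∈ S, (W α)ᴴ * x * W β = 0) ∧
      (∀ α β, α ≠ β → ∀ y, (∀ x ∈ S, Commute x y) → (W α)ᴴ * y * W β = 0) ∧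
      (∀ α, ∀ x ∈ S, ∃ z : Matrix (Fin (a α)) (Fin (a α)) ℂ, (W α)ᴴ * x * W α = z ⊗ₖ 1) ∧
      (∀ α, ∀ y, (∀ x ∈ S, Commute x y) →
        ∃ z : Matrix (Fin (b α)) (Fin (b α)) ℂ, (W α)ᴴ * y * W α = 1 ⊗ₖ z) := by
  obtain ⟨ι, _, _, d, U, u1, u2, u3, u4, u5, u6⟩ := bv_irred n (Fin n) (by simp) S hS
  -- the projections commute with S
  have hl : ∀ i, ∀ x ∈ S, (U i)ᴴ * x = (U i)ᴴ * x * U i * (U i)ᴴ := by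
    intro i x hx
    calc (U i)ᴴ * x = (U i)ᴴ * x * ∑ j, U j * (U j)ᴴ := by rw [u4, Matrix.mul_one]
      _ = ∑ j, (U i)ᴴ * x * U j * (U j)ᴴ := by
        rw [Matrix.mul_sum]; simp only [Matrix.mul_assoc]
      _ = _ := by
        rw [Finset.sum_eq_single i]
        · intro j _ hj; rw [u5 i j hj.symm x hx]; simp
        · simp
  have hr : ∀ i, ∀ x ∈ S, x * U i = U i * ((U i)ᴴ * x * U i) := by
    intro i x hx
    have := congrArg conjTranspose (hl i xᴴ (hS x hx))
    simpa [Matrix.mul_assoc] using this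
  let r : ι → ι → Prop := fun i j => ∃ R : Matrix (Fin (d i)) (Fin (d j)) ℂ,
    R * Rᴴ = 1 ∧ Rᴴ * R = 1 ∧ ∀ x ∈ S, ((U i)ᴴ * x * U i) * R = R * ((U j)ᴴ * x * U j)
  have schur : ∀ i j, ∀ T : Matrix (Fin (d i)) (Fin (d j)) ℂ,
      (∀ x ∈ S, ((U i)ᴴ * x * U i) * T = T * ((U j)ᴴ * x * U j)) → T ≠ 0 → r i j := by
    intro i j T hT hT0
    exact bv_schur S (fun x => (U i)ᴴ * x * U i) (fun x => (U j)ᴴ * x * U j) conjTranspose hS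
      (by intro x; simp [Matrix.mul_assoc]) (by intro x; simp [Matrix.mul_assoc])
      (u6 i) (u6 j) T hT hT0
  have intertw : ∀ i j y, (∀ x ∈ S, Commute x y) → ∀ x ∈ S,
      ((U i)ᴴ * x * U i) * ((U i)ᴴ * y * U j) = ((U i)ᴴ * y * U j) * ((U j)ᴴ * x * U j) := by
    intro i j y hy x hx
    calc ((U i)ᴴ * x * U i) * ((U i)ᴴ * y * U j) = ((U i)ᴴ * x * U i * (U i)ᴴ) * y * U j := by
          simp only [Matrix.mul_assoc]
      _ = (U i)ᴴ * (x * y) * U j := by rw [← hl i x hx]; simp only [Matrix.mul_assoc]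
      _ = (U i)ᴴ * y * (x * U j) := by rw [(hy x hx).eq]; simp only [Matrix.mul_assoc]
      _ = _ := by rw [hr j x hx]; simp only [Matrix.mul_assoc]
  let st : Setoid ι := ⟨r, ⟨fun i => ⟨1, by simp, by simp, by simp⟩, by
    rintro i j ⟨R, h1, h2, h3⟩
    refine ⟨Rᴴ, by simpa using h2, by simpa using h1, fun x hx => ?_⟩
    have := congrArg conjTranspose (h3 _ (hS x hx))
    simpa [Matrix.mul_assoc] using this.symm, by
    rintro i j k ⟨R, h1, h2, h3⟩ ⟨R', h1', h2', h3'⟩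
    refine ⟨R * R', ?_, ?_, fun x hx => ?_⟩
    · calc R * R' * (R * R')ᴴ = R * (R' * R'ᴴ) * Rᴴ := by simp only [conjTranspose_mul, Matrix.mul_assoc]
        _ = 1 := by rw [h1', Matrix.mul_one, h1]
    · calc (R * R')ᴴ * (R * R') = R'ᴴ * (Rᴴ * R) * R' := by simp only [conjTranspose_mul, Matrix.mul_assoc]
        _ = 1 := by rw [h2, Matrix.mul_one, h2']
    · rw [← Matrix.mul_assoc, h3 x hx, Matrix.mul_assoc R, h3' x hx, ← Matrix.mul_assoc R]⟩⟩
  classical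
  let Q := Quotient st
  have hrep : ∀ (q : Q) (i : {i : ι // (⟦i⟧ : Q) = q}), r i q.out := by
    intro q i
    have : (⟦i.1⟧ : Q) = ⟦q.out⟧ := by rw [i.2, Quotient.out_eq]
    exact Quotient.exact this
  choose R R1 R2 R3 using hrep
  let V : (q : Q) → (i : {i : ι // (⟦i⟧ : Q) = q}) → Matrix (Fin n) (Fin (d q.out)) ℂ :=
    fun q i => U i * R q i
  have vM : ∀ q q' i j (M : Matrix (Fin n) (Fin n) ℂ), (V q i)ᴴ * M * V q' j
      = (R q i)ᴴ * ((U i)ᴴ * M * U j) * R q' j := by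
    intros; simp only [V, conjTranspose_mul, Matrix.mul_assoc]
  have vne : ∀ q q' (i : {i : ι // (⟦i⟧ : Q) = q}) (j : {i : ι // (⟦i⟧ : Q) = q'}),
      q ≠ q' → i.1 ≠ j.1 := by
    intro q q' i j h hij
    exact h (by rw [← i.2, ← j.2, hij])
  have vv : ∀ q i, V q i * (V q i)ᴴ = U i * (U i)ᴴ := by
    intro q i
    calc V q i * (V q i)ᴴ = U i * (R q i * (R q i)ᴴ) * (U i)ᴴ := by
          simp only [V, conjTranspose_mul, Matrix.mul_assoc]
      _ = _ := by rw [R1, Matrix.mul_one]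
  have v1 : ∀ q i, (V q i)ᴴ * (1 : Matrix (Fin n) (Fin n) ℂ) * V q i = 1 := by
    intro q i; rw [vM, Matrix.mul_one, u2, Matrix.mul_one, R2]
  have v2 : ∀ q q' (i : {i : ι // (⟦i⟧ : Q) = q}) (j : {i : ι // (⟦i⟧ : Q) = q'}),
      i.1 ≠ j.1 → (V q i)ᴴ * (1 : Matrix (Fin n) (Fin n) ℂ) * V q' j = 0 := by
    intro q q' i j hij; rw [vM, Matrix.mul_one, u3 _ _ hij]; simp
  have v3 : ∀ q i, ∀ x ∈ S, (V q i)ᴴ * x * V q i = (U q.out)ᴴ * x * U q.out := by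
    intro q i x hx; rw [vM, Matrix.mul_assoc, R3 q i x hx, ← Matrix.mul_assoc, R2, Matrix.one_mul]
  have v4 : ∀ q q' (i : {i : ι // (⟦i⟧ : Q) = q}) (j : {i : ι // (⟦i⟧ : Q) = q'}),
      i.1 ≠ j.1 → ∀ x ∈ S, (V q i)ᴴ * x * V q' j = 0 := by
    intro q q' i j hij x hx; rw [vM, u5 _ _ hij x hx]; simp
  have v5 : ∀ q q' (i : {i : ι // (⟦i⟧ : Q) = q}) (j : {i : ι // (⟦i⟧ : Q) = q'}),
      q ≠ q' → ∀ y, (∀ x ∈ S, Commute x y) → (V q i)ᴴ * y * V q' j = 0 := by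
    intro q q' i j hqq y hy
    rw [vM]
    have : (U i)ᴴ * y * U j = 0 := by
      by_contra hne
      have hr := schur i.1 j.1 _ (intertw i j y hy) hne
      apply hqq
      rw [← i.2, ← j.2]
      exact Quotient.sound hr
    rw [this]; simp
  have v6 : ∀ q i j, ∀ y, (∀ x ∈ S, Commute x y) → ∃ c : ℂ, (V q i)ᴴ * y * V q j = c • 1 := by
    intro q i j y hy
    apply u6 q.out
    intro x hx
    have hi : (R q i)ᴴ * ((U i)ᴴ * x * U i) = ((U q.out)ᴴ * x * U q.out) * (R q i)ᴴ := by
      have := congrArg conjTranspose (R3 q i _ (hS x hx))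
      simpa [Matrix.mul_assoc] using this
    rw [commute_iff_eq, vM]
    calc (U q.out)ᴴ * x * U q.out * ((R q i)ᴴ * ((U i)ᴴ * y * U j) * R q j)
        = ((U q.out)ᴴ * x * U q.out * (R q i)ᴴ) * ((U i)ᴴ * y * U j) * R q j := by
          simp only [Matrix.mul_assoc]
      _ = (R q i)ᴴ * (((U i)ᴴ * x * U i) * ((U i)ᴴ * y * U j)) * R q j := by
          rw [← hi]; simp only [Matrix.mul_assoc]
      _ = (R q i)ᴴ * ((U i)ᴴ * y * U j) * (((U j)ᴴ * x * U j) * R q j) := by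
          rw [intertw i j y hy x hx]; simp only [Matrix.mul_assoc]
      _ = _ := by rw [R3 q j x hx]; simp only [Matrix.mul_assoc]
  let b : Q → ℕ := fun q => Fintype.card {i : ι // (⟦i⟧ : Q) = q}
  let e : (q : Q) → Fin (b q) ≃ {i : ι // (⟦i⟧ : Q) = q} := fun q => (Fintype.equivFin _).symm
  let W : (q : Q) → Matrix (Fin n) (Fin (d q.out) × Fin (b q)) ℂ :=
    fun q => Matrix.of fun x kl => V q (e q kl.2) x kl.1
  have wM : ∀ q q' (M : Matrix (Fin n) (Fin n) ℂ) k l k' l', ((W q)ᴴ * M * W q') (k, l) (k', l')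
      = ((V q (e q l))ᴴ * M * V q' (e q' l')) k k' := by
    intros; simp [W, Matrix.mul_apply]
  have wM1 : ∀ q q', (W q)ᴴ * W q' = (W q)ᴴ * (1 : Matrix (Fin n) (Fin n) ℂ) * W q' := by intros; rw [Matrix.mul_one]
  have ene : ∀ q l l', l ≠ l' → (e q l).1 ≠ (e q l').1 := by
    intro q l l' h h'
    exact h ((e q).injective (Subtype.ext h'))
  have w0 : ∀ q, 1 ≤ d q.out ∧ 1 ≤ b q := by
    intro q
    refine ⟨u1 _, ?_⟩
    exact Fintype.card_pos_iff.mpr ⟨⟨q.out, Quotient.out_eq q⟩⟩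
  have w1 : ∀ q, (W q)ᴴ * W q = 1 := by
    intro q
    ext ⟨k, l⟩ ⟨k', l'⟩
    rw [wM1, wM]
    by_cases h : l = l'
    · subst h
      rw [v1]; simp [Matrix.one_apply]
    · rw [v2 _ _ _ _ (ene q l l' h)]; simp [Matrix.one_apply, h]
  have w2 : ∀ q q', q ≠ q' → (W q)ᴴ * W q' = 0 := by
    intro q q' h
    ext ⟨k, l⟩ ⟨k', l'⟩
    rw [wM1, wM, v2 _ _ _ _ (vne _ _ _ _ h)]; simp
  have w3 : ∑ q, W q * (W q)ᴴ = 1 := by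
    have h : ∀ q, W q * (W q)ᴴ = ∑ i : {i : ι // (⟦i⟧ : Q) = q}, U i * (U i)ᴴ := by
      intro q
      rw [← Equiv.sum_comp (e q)]
      simp only [← vv]
      ext x y
      rw [Matrix.sum_apply]
      simp only [Matrix.mul_apply, W, Matrix.of_apply, conjTranspose_apply]
      rw [Fintype.sum_prod_type, Finset.sum_comm]
    simp only [h]
    rw [← u4]
    exact Fintype.sum_fiberwise (fun i => (⟦i⟧ : Q)) (fun i => U i * (U i)ᴴ)
  have w4 : ∀ q q', q ≠ q' → ∀ x ∈ S, (W q)ᴴ * x * W q' = 0 := by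
    intro q q' h x hx
    ext ⟨k, l⟩ ⟨k', l'⟩
    rw [wM, v4 _ _ _ _ (vne _ _ _ _ h) x hx]; simp
  have w5 : ∀ q q', q ≠ q' → ∀ y, (∀ x ∈ S, Commute x y) → (W q)ᴴ * y * W q' = 0 := by
    intro q q' h y hy
    ext ⟨k, l⟩ ⟨k', l'⟩
    rw [wM, v5 _ _ _ _ h y hy]; simp
  have w6 : ∀ q, ∀ x ∈ S, ∃ z : Matrix (Fin (d q.out)) (Fin (d q.out)) ℂ,
      (W q)ᴴ * x * W q = z ⊗ₖ 1 := by
    intro q x hx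
    refine ⟨(U q.out)ᴴ * x * U q.out, ?_⟩
    ext ⟨k, l⟩ ⟨k', l'⟩
    rw [wM, kronecker_apply]
    by_cases h : l = l'
    · subst h
      rw [v3 _ _ x hx]; simp
    · rw [v4 _ _ _ _ (ene q l l' h) x hx]; simp [h]
  have w7 : ∀ q, ∀ y, (∀ x ∈ S, Commute x y) →
      ∃ z : Matrix (Fin (b q)) (Fin (b q)) ℂ, (W q)ᴴ * y * W q = 1 ⊗ₖ z := by
    intro q y hy
    choose c hc using fun l l' => v6 q (e q l) (e q l') y hy
    refine ⟨Matrix.of c, ?_⟩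
    ext ⟨k, l⟩ ⟨k', l'⟩
    rw [wM, hc, kronecker_apply]
    simp [mul_comm]
  let f : Fin (Fintype.card Q) ≃ Q := (Fintype.equivFin Q).symm
  refine ⟨Fintype.card Q, fun α => d (f α).out, fun α => b (f α), fun α => W (f α),
    fun α => w0 _, fun α => w1 _, fun α β h => w2 _ _ (f.injective.ne h), ?_,
    fun α β h => w4 _ _ (f.injective.ne h), fun α β h => w5 _ _ (f.injective.ne h),
    fun α => w6 _, fun α => w7 _⟩
  rw [← w3]
  exact Equiv.sum_comp f (fun q => W q * (W q)ᴴ)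

theorem bv_comm {n N : ℕ} {a b : Fin N → ℕ}
    (W : (α : Fin N) → Matrix (Fin n) (Fin (a α) × Fin (b α)) ℂ)
    (hs : (∑ α, W α * (W α)ᴴ) = 1) (x : Matrix (Fin n) (Fin n) ℂ)
    (hx : ∀ α β, α ≠ β → (W α)ᴴ * x * W β = 0) (α : Fin N) :
    Commute x (W α * (W α)ᴴ) := by
  have h1 : W α * (W α)ᴴ * x = W α * ((W α)ᴴ * x * W α) * (W α)ᴴ := by
    calc W α * (W α)ᴴ * x = W α * (W α)ᴴ * x * ∑ β, W β * (W β)ᴴ := by rw [hs, Matrix.mul_one]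
      _ = ∑ β, W α * ((W α)ᴴ * x * W β) * (W β)ᴴ := by
        rw [Matrix.mul_sum]; simp only [Matrix.mul_assoc]
      _ = _ := by
        rw [Finset.sum_eq_single α]
        · intro j _ hj; rw [hx α j hj.symm]; simp
        · simp
  have h2 : x * (W α * (W α)ᴴ) = W α * ((W α)ᴴ * x * W α) * (W α)ᴴ := by
    calc x * (W α * (W α)ᴴ) = (∑ β, W β * (W β)ᴴ) * x * (W α * (W α)ᴴ) := by
          rw [hs, Matrix.one_mul]
      _ = ∑ β, W β * ((W β)ᴴ * x * W α) * (W α)ᴴ := by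
        rw [Matrix.sum_mul, Matrix.sum_mul]; simp only [Matrix.mul_assoc]
      _ = _ := by
        rw [Finset.sum_eq_single α]
        · intro j _ hj; rw [hx j α hj]; simp
        · simp
  rw [commute_iff_eq, h1, h2]

theorem bv_scalar {n : ℕ} {m : Type} [Fintype m] [DecidableEq m] (W : Matrix (Fin n) m ℂ)
    (hW : W * Wᴴ = 1) (x : Matrix (Fin n) (Fin n) ℂ) (c : ℂ) (h : Wᴴ * x * W = c • 1) :
    x = c • 1 := by
  calc x = (W * Wᴴ) * x * (W * Wᴴ) := by rw [hW]; simp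
    _ = W * (Wᴴ * x * W) * Wᴴ := by simp only [Matrix.mul_assoc]
    _ = c • 1 := by rw [h]; simp [hW]

/-- Bravyi–Vyalyi structure lemma. Model the nonzero finite-dimensional
complex inner product spaces `H₁, H₂, H₃` (with `dim H₂ ≥ 2`) as `ℂ^(Fin n₁)`,
`ℂ^(Fin n₂)`, `ℂ^(Fin n₃)`, a self-adjoint operator `A` on `H₁ ⊗ H₂` as a Hermitian
matrix indexed by `Fin n₁ × Fin n₂`, and similarly `B` on `H₂ ⊗ H₃`; assume
`A ⊗ I₃` and `I₁ ⊗ B` commute on `H₁ ⊗ H₂ ⊗ H₃`. Then `H₂` decomposes into pairwise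
orthogonal nonzero subspaces `V_α` (given by isometries `W α` onto them with
mutually orthogonal ranges summing to the identity) with unitary identifications
`V_α ≅ V_α^A ⊗ V_α^B` (`V_α^A = ℂ^(Fin (a α))`, `V_α^B = ℂ^(Fin (b α))`, both nonzero),
such that (i) `A` preserves each `H₁ ⊗ V_α` and `B` preserves each `V_α ⊗ H₃`;
(ii) the restriction of `A` to `H₁ ⊗ V_α`, conjugated by the identification, is
`a_α ⊗ I` for some operator `a_α` on `H₁ ⊗ V_α^A`; (iii) the restriction of `B` to
`V_α ⊗ H₃` is `I ⊗ b_α` for some `b_α` on `V_α^B ⊗ H₃`. Moreover, if `A` is not of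
the form `a ⊗ I` and `B` is not of the form `I ⊗ b`, the decomposition can be chosen
with `dim V_α^A < dim H₂` and `dim V_α^B < dim H₂` for every `α`. -/
theorem stmt_1 (n₁ n₂ n₃ : ℕ) (h1 : 1 ≤ n₁) (h2 : 2 ≤ n₂) (h3 : 1 ≤ n₃)
    (A : Matrix (Fin n₁ × Fin n₂) (Fin n₁ × Fin n₂) ℂ) (hA : A.IsHermitian)
    (B : Matrix (Fin n₂ × Fin n₃) (Fin n₂ × Fin n₃) ℂ) (hB : B.IsHermitian)
    (hcomm : Commute
      (Matrix.reindex (Equiv.prodAssoc (Fin n₁) (Fin n₂) (Fin n₃))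
        (Equiv.prodAssoc (Fin n₁) (Fin n₂) (Fin n₃))
        (A ⊗ₖ (1 : Matrix (Fin n₃) (Fin n₃) ℂ)))
      ((1 : Matrix (Fin n₁) (Fin n₁) ℂ) ⊗ₖ B)) :
    ∃ (N : ℕ) (a b : Fin N → ℕ)
      (W : (α : Fin N) → Matrix (Fin n₂) (Fin (a α) × Fin (b α)) ℂ),
      -- the subspaces V_α and the tensor factors are nonzero
      (∀ α, 1 ≤ a α ∧ 1 ≤ b α) ∧
      -- W α is an isometry of V_α^A ⊗ V_α^B onto the subspace V_α ⊆ H₂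
      (∀ α, (W α)ᴴ * W α = 1) ∧
      -- the subspaces V_α are pairwise orthogonal
      (∀ α β, α ≠ β → (W α)ᴴ * W β = 0) ∧
      -- the direct sum of the V_α is all of H₂
      (∑ α, W α * (W α)ᴴ) = 1 ∧
      -- (i): A maps H₁ ⊗ V_α into itself and B maps V_α ⊗ H₃ into itself
      (∀ α, Commute A ((1 : Matrix (Fin n₁) (Fin n₁) ℂ) ⊗ₖ (W α * (W α)ᴴ))) ∧
      (∀ α, Commute B ((W α * (W α)ᴴ) ⊗ₖ (1 : Matrix (Fin n₃) (Fin n₃) ℂ))) ∧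
      -- (ii): on H₁ ⊗ V_α, A acts as a_α ⊗ I_{V_α^B}
      (∀ α, ∃ aop : Matrix (Fin n₁ × Fin (a α)) (Fin n₁ × Fin (a α)) ℂ,
        ((1 : Matrix (Fin n₁) (Fin n₁) ℂ) ⊗ₖ W α)ᴴ * A
            * ((1 : Matrix (Fin n₁) (Fin n₁) ℂ) ⊗ₖ W α)
          = Matrix.reindex (Equiv.prodAssoc (Fin n₁) (Fin (a α)) (Fin (b α)))
              (Equiv.prodAssoc (Fin n₁) (Fin (a α)) (Fin (b α)))
              (aop ⊗ₖ (1 : Matrix (Fin (b α)) (Fin (b α)) ℂ))) ∧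
      -- (iii): on V_α ⊗ H₃, B acts as I_{V_α^A} ⊗ b_α
      (∀ α, ∃ bop : Matrix (Fin (b α) × Fin n₃) (Fin (b α) × Fin n₃) ℂ,
        (W α ⊗ₖ (1 : Matrix (Fin n₃) (Fin n₃) ℂ))ᴴ * B
            * (W α ⊗ₖ (1 : Matrix (Fin n₃) (Fin n₃) ℂ))
          = Matrix.reindex (Equiv.prodAssoc (Fin (a α)) (Fin (b α)) (Fin n₃)).symm
              (Equiv.prodAssoc (Fin (a α)) (Fin (b α)) (Fin n₃)).symm
              ((1 : Matrix (Fin (a α)) (Fin (a α)) ℂ) ⊗ₖ bop)) ∧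
      -- moreover: if A is not of the form a ⊗ I and B not of the form I ⊗ b, the
      -- decomposition can be chosen with dim V_α^A < dim H₂ and dim V_α^B < dim H₂
      ((¬ ∃ a0 : Matrix (Fin n₁) (Fin n₁) ℂ,
          A = a0 ⊗ₖ (1 : Matrix (Fin n₂) (Fin n₂) ℂ)) →
       (¬ ∃ b0 : Matrix (Fin n₃) (Fin n₃) ℂ,
          B = (1 : Matrix (Fin n₂) (Fin n₂) ℂ) ⊗ₖ b0) →
       ∀ α, a α < n₂ ∧ b α < n₂) := by
  
  let bA : Fin n₁ → Fin n₁ → Matrix (Fin n₂) (Fin n₂) ℂ :=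
    fun p q => Matrix.of fun k l => A (p, k) (q, l)
  let bB : Fin n₃ → Fin n₃ → Matrix (Fin n₂) (Fin n₂) ℂ :=
    fun s t => Matrix.of fun k l => B (k, s) (l, t)
  have hAB : ∀ p q s t, Commute (bA p q) (bB s t) := by
    intro p q s t
    rw [commute_iff_eq]
    ext k l
    have h := congrFun (congrFun hcomm.eq (p, (k, s))) (q, (l, t))
    simp only [Matrix.mul_apply, Fintype.sum_prod_type, reindex_apply, submatrix_apply,
      Equiv.prodAssoc_symm_apply, kronecker_apply, Matrix.one_apply] at h
    simp only [Matrix.mul_apply, bA, bB, Matrix.of_apply]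
    simpa [Finset.sum_ite_eq, ite_mul, mul_ite, Finset.sum_comm (s := (Finset.univ : Finset (Fin n₁))), mul_comm] using h
  let S : Set (Matrix (Fin n₂) (Fin n₂) ℂ) := {x | ∃ p q, x = bA p q}
  have hS : ∀ x ∈ S, xᴴ ∈ S := by
    rintro _ ⟨p, q, rfl⟩
    refine ⟨q, p, ?_⟩
    ext k l
    simp only [bA, conjTranspose_apply, Matrix.of_apply]
    exact hA.apply _ _
  have hBS : ∀ s t, ∀ x ∈ S, Commute x (bB s t) := by
    rintro s t _ ⟨p, q, rfl⟩
    exact hAB p q s t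
  obtain ⟨N, a, b, W, w0, w1, w2, w3, w4, w5, w6, w7⟩ := bv_struct n₂ S hS
  refine ⟨N, a, b, W, w0, w1, w2, w3, ?_, ?_, ?_, ?_, ?_⟩
  · intro α
    rw [commute_iff_eq]
    ext ⟨p, k⟩ ⟨q, l⟩
    have h := congrFun (congrFun (bv_comm W w3 (bA p q)
      (fun α β hαβ => w4 α β hαβ _ ⟨p, q, rfl⟩) α).eq k) l
    generalize W α * (W α)ᴴ = P at h ⊢
    simp only [Matrix.mul_apply, Fintype.sum_prod_type, kronecker_apply, Matrix.one_apply, bA,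
      Matrix.of_apply] at h ⊢
    rw [Finset.sum_comm, Finset.sum_comm (s := (Finset.univ : Finset (Fin n₁)))]
    simpa [ite_mul, mul_ite] using h
  · intro α
    rw [commute_iff_eq]
    ext ⟨k, s⟩ ⟨l, t⟩
    have h := congrFun (congrFun (bv_comm W w3 (bB s t)
      (fun α β hαβ => w5 α β hαβ _ (hBS s t)) α).eq k) l
    generalize W α * (W α)ᴴ = P at h ⊢
    simp only [Matrix.mul_apply, Fintype.sum_prod_type, kronecker_apply, Matrix.one_apply, bB,
      Matrix.of_apply] at h ⊢
    simpa [ite_mul, mul_ite] using h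
  · intro α
    choose z hz using fun p q => w6 α (bA p q) ⟨p, q, rfl⟩
    refine ⟨Matrix.of fun i j => z i.1 j.1 i.2 j.2, ?_⟩
    ext ⟨p, k, l⟩ ⟨q, k', l'⟩
    have h := congrFun (congrFun (hz p q) (k, l)) (k', l')
    simp only [reindex_apply, submatrix_apply, Equiv.prodAssoc_symm_apply, kronecker_apply,
      Matrix.of_apply] at h ⊢
    rw [← h]
    simp only [Matrix.mul_apply, Fintype.sum_prod_type, kronecker_apply, Matrix.one_apply, bA,
      Matrix.of_apply, conjTranspose_apply]
    rw [Finset.sum_comm]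
    simp [ite_mul, mul_ite, apply_ite]
  · intro α
    choose z hz using fun s t => w7 α (bB s t) (hBS s t)
    refine ⟨Matrix.of fun i j => z i.2 j.2 i.1 j.1, ?_⟩
    ext ⟨⟨k, l⟩, s⟩ ⟨⟨k', l'⟩, t⟩
    have h := congrFun (congrFun (hz s t) (k, l)) (k', l')
    simp only [reindex_apply, submatrix_apply, Equiv.symm_symm, Equiv.prodAssoc_apply,
      kronecker_apply, Matrix.of_apply] at h ⊢
    rw [← h]
    simp only [Matrix.mul_apply, Fintype.sum_prod_type, kronecker_apply, Matrix.one_apply, bB,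
      Matrix.of_apply, conjTranspose_apply]
    simp [ite_mul, mul_ite, apply_ite]
  · intro hAn hBn α
    have hle : a α * b α ≤ n₂ := by
      have h1 : ((W α)ᴴ * W α).rank ≤ (W α).rank := rank_mul_le_right _ _
      have h2 := (W α).rank_le_card_height
      rw [w1, rank_one] at h1
      simpa using h1.trans h2
    have hun : a α * b α = n₂ → W α * (W α)ᴴ = 1 := by
      intro h
      have hc : Fintype.card (Fin (a α) × Fin (b α)) = Fintype.card (Fin n₂) := by simpa using h
      exact (mul_eq_one_comm_of_card_eq _ _ _ hc).mp (w1 α)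
    obtain ⟨ha, hb⟩ := w0 α
    have one_sc : ∀ {m : ℕ}, m = 1 → ∀ z : Matrix (Fin m) (Fin m) ℂ, ∃ c : ℂ, z = c • 1 := by
      rintro m rfl z
      exact ⟨z 0 0, by ext i j; simp [Subsingleton.elim i 0, Subsingleton.elim j 0]⟩
    constructor
    · by_contra hcon
      push Not at hcon
      have hb1 : b α = 1 := by nlinarith
      have hW := hun (by rw [hb1] at hle ⊢; omega)
      apply hBn
      have : ∀ s t, ∃ c : ℂ, bB s t = c • 1 := by
        intro s t
        obtain ⟨z, hz⟩ := w7 α (bB s t) (hBS s t)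
        obtain ⟨c, rfl⟩ := one_sc hb1 z
        exact ⟨c, bv_scalar _ hW _ c (by rw [hz, kronecker_smul, one_kronecker_one])⟩
      choose c hc using this
      refine ⟨Matrix.of c, ?_⟩
      ext ⟨k, s⟩ ⟨l, t⟩
      have h := congrFun (congrFun (hc s t) k) l
      simpa [bB, mul_comm] using h
    · by_contra hcon
      push Not at hcon
      have ha1 : a α = 1 := by nlinarith
      have hW := hun (by rw [ha1] at hle ⊢; omega)
      apply hAn
      have : ∀ s t, ∃ c : ℂ, bA s t = c • 1 := by
        intro s t
        obtain ⟨z, hz⟩ := w6 α (bA s t) ⟨s, t, rfl⟩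
        obtain ⟨c, rfl⟩ := one_sc ha1 z
        exact ⟨c, bv_scalar _ hW _ c (by rw [hz, smul_kronecker, one_kronecker_one])⟩
      choose c hc using this
      refine ⟨Matrix.of c, ?_⟩
      ext ⟨s, k⟩ ⟨t, l⟩
      have h := congrFun (congrFun (hc s t) k) l
      simpa [bA] using h
end

section
/- Let H₁, H₂ be nonzero finite-dimensional complex inner product spaces, J a finite index set, and for each j ∈ J let K_j be a nonzero finite-dimensional complex inner product space. Let A be a self-adjoint operator on H₁ ⊗ H₂, and for each j ∈ J let B_j be a self-adjoint operator on H₂ ⊗ K_j. Assume that for every j ∈ J, the operators A ⊗ I_{K_j} and I_{H₁} ⊗ B_j on H₁ ⊗ H₂ ⊗ K_j commute (after the evident reassociation of tensor factors). Then there exist a finite index set 𝒜, pairwise orthogonal nonzero subspaces {V_α}_{α∈𝒜} of H₂ whose direct sum is H₂, and for each α nonzero finite-dimensional complex inner product spaces V_α⁰, V_α¹ together with a unitary isomorphism u_α : V_α ≅ V_α⁰ ⊗ V_α¹, such that: (i) A maps H₁ ⊗ V_α into itself and every B_j maps V_α ⊗ K_j into itself; (ii) for each α, the restriction of A to H₁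 ⊗ V_α, conjugated by I_{H₁} ⊗ u_α, equals a_α ⊗ I_{V_α¹} for some operator a_α on H₁ ⊗ V_α⁰; (iii) for each α and each j, the restriction of B_j to V_α ⊗ K_j, conjugated by u_α ⊗ I_{K_j}, equals I_{V_α⁰} ⊗ b_{j,α} for some operator b_{j,α} on V_α¹ ⊗ K_j. Moreover, if dim H₂ ≥ 2, A is not of the form a ⊗ I_{H₂}, and some B_j is not of the form I_{H₂} ⊗ b, then the decomposition can be chosen so that dim V_α⁰ < dim H₂ and dim V_α¹ < dim H₂ for every α. -/
open Matrix Kronecker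


/-- A family of matrices is irreducible if only scalars commute with it. -/
def BVIrr {S ι : Type} [Fintype ι] [DecidableEq ι] (ρ : S → Matrix ι ι ℂ) : Prop :=
  ∀ X : Matrix ι ι ℂ, (∀ s, ρ s * X = X * ρ s) → ∃ c : ℂ, X = c • (1 : Matrix ι ι ℂ)

lemma bv_exists_herm {S ι : Type} [Fintype ι] [DecidableEq ι] (ρ : S → Matrix ι ι ℂ)
    (τ : S → S) (hτ : ∀ s, ρ (τ s) = (ρ s)ᴴ) (h : ¬ BVIrr ρ) :
    ∃ Y : Matrix ι ι ℂ, Y.IsHermitian ∧ (∀ s, ρ s * Y = Y * ρ s) ∧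
      ¬ ∃ c : ℂ, Y = c • (1 : Matrix ι ι ℂ) := by
  by_contra hcon
  push Not at hcon
  apply h
  intro X hX
  have hX' : ∀ s, ρ s * Xᴴ = Xᴴ * ρ s := by
    intro s
    have := congrArg conjTranspose (hX (τ s))
    rw [conjTranspose_mul, conjTranspose_mul, hτ, conjTranspose_conjTranspose] at this
    exact this.symm
  obtain ⟨c, hc⟩ := hcon (X + Xᴴ) (by
    simp [Matrix.IsHermitian, conjTranspose_add, add_comm]) (by
    intro s; rw [mul_add, add_mul, hX, hX'])
  obtain ⟨c', hc'⟩ := hcon (Complex.I • (X - Xᴴ)) (by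
    simp [Matrix.IsHermitian, conjTranspose_sub, conjTranspose_smul]
    rw [← smul_neg, neg_sub]) (by
    intro s; rw [Matrix.mul_smul, Matrix.smul_mul, mul_sub, sub_mul, hX, hX'])
  refine ⟨(c - Complex.I * c') / 2, ?_⟩
  have e : X = (1/2 : ℂ) • ((X + Xᴴ) - Complex.I • (Complex.I • (X - Xᴴ))) := by
    rw [smul_smul, Complex.I_mul_I]
    module
  rw [e, hc, hc']
  module

lemma bv_split {S ι : Type} [Fintype ι] [DecidableEq ι] (ρ : S → Matrix ι ι ℂ)
    (τ : S → S) (hτ : ∀ s, ρ (τ s) = (ρ s)ᴴ) (h : ¬ BVIrr ρ) :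
    ∃ (p : ι → Prop) (_ : DecidablePred p) (v : Matrix ι {i // p i} ℂ)
      (w : Matrix ι {i // ¬ p i} ℂ),
      (∃ i, p i) ∧ (∃ i, ¬ p i) ∧ vᴴ * v = 1 ∧ wᴴ * w = 1 ∧ vᴴ * w = 0 ∧ wᴴ * v = 0 ∧
      v * vᴴ + w * wᴴ = 1 ∧ (∀ s, ρ s * v = v * (vᴴ * ρ s * v)) ∧
      (∀ s, ρ s * w = w * (wᴴ * ρ s * w)) := by
  classical
  obtain ⟨Y, hY, hc, hn⟩ := bv_exists_herm ρ τ hτ h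
  set D := hY.eigenvalues with hD
  set U : Matrix ι ι ℂ := (hY.eigenvectorUnitary : Matrix ι ι ℂ) with hU
  have hU1 : Uᴴ * U = 1 := by
    have := Unitary.coe_star_mul_self hY.eigenvectorUnitary
    simpa [star_eq_conjTranspose] using this
  have hU2 : U * Uᴴ = 1 := by
    have := Unitary.coe_mul_star_self hY.eigenvectorUnitary
    simpa [star_eq_conjTranspose] using this
  have hsp : Y = U * diagonal (fun i => (D i : ℂ)) * Uᴴ := by
    have := hY.spectral_theorem
    simpa [Unitary.conjStarAlgAut_apply, star_eq_conjTranspose, Function.comp_def] using this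
  have hne : ∃ i j, D i ≠ D j := by
    by_contra hcon
    push Not at hcon
    apply hn
    rcases isEmpty_or_nonempty ι with hι | ⟨⟨i0⟩⟩
    · exact ⟨0, Subsingleton.elim _ _⟩
    · refine ⟨D i0, ?_⟩
      rw [hsp]
      have : (fun i => (D i : ℂ)) = fun _ => (D i0 : ℂ) := by
        funext i; rw [hcon i i0]
      rw [this, ← smul_one_eq_diagonal, Matrix.mul_smul, mul_one, Matrix.smul_mul, hU2]
  obtain ⟨i0, j0, hij⟩ := hne
  -- the conjugated family is block diagonal
  have hblk : ∀ s i j, D i ≠ D j → (Uᴴ * ρ s * U) i j = 0 := by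
    intro s i j hd
    have e1 : (Uᴴ * ρ s * U) * diagonal (fun i => (D i : ℂ))
        = diagonal (fun i => (D i : ℂ)) * (Uᴴ * ρ s * U) := by
      have hDY : diagonal (fun i => (D i : ℂ)) = Uᴴ * Y * U := by
        rw [hsp]
        simp only [Matrix.mul_assoc, hU1, Matrix.mul_one]
        rw [← Matrix.mul_assoc, hU1, Matrix.one_mul]
      rw [hDY]
      calc Uᴴ * ρ s * U * (Uᴴ * Y * U) = Uᴴ * ρ s * (U * Uᴴ) * Y * U := by
            simp only [Matrix.mul_assoc]
        _ = Uᴴ * (ρ s * Y) * U := by rw [hU2]; simp only [Matrix.mul_assoc, Matrix.one_mul]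
        _ = Uᴴ * Y * (U * Uᴴ) * ρ s * U := by
            rw [hU2, hc]; simp only [Matrix.mul_assoc, Matrix.one_mul]
        _ = _ := by simp only [Matrix.mul_assoc]
    have e2 := congrFun (congrFun e1 i) j
    rw [mul_diagonal, diagonal_mul] at e2
    have e3 : ((D i : ℂ) - D j) * (Uᴴ * ρ s * U) i j = 0 := by
      rw [sub_mul, ← e2]; ring
    rcases mul_eq_zero.1 e3 with e | e
    · exact absurd (by exact_mod_cast sub_eq_zero.1 e) hd
    · exact e
  -- abstract splitting
  have key : ∀ (q : ι → Prop) [DecidablePred q], (∀ i j, q i → D j = D i → q j) →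
      ∀ s, ρ s * U.submatrix id (Subtype.val : {i // q i} → ι) =
        U.submatrix id (Subtype.val : {i // q i} → ι) *
        ((U.submatrix id (Subtype.val : {i // q i} → ι))ᴴ * ρ s *
          U.submatrix id (Subtype.val : {i // q i} → ι)) := by
    intro q _ hq s
    have e : ρ s * U = U * (Uᴴ * ρ s * U) := by
      rw [← Matrix.mul_assoc, ← Matrix.mul_assoc, hU2, Matrix.one_mul]
    have e0 : (U.submatrix id (Subtype.val : {i // q i} → ι))ᴴ * ρ s *
          U.submatrix id (Subtype.val : {i // q i} → ι) =
        (Uᴴ * ρ s * U).submatrix Subtype.val Subtype.val := by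
      ext i j; simp [Matrix.mul_apply]
    rw [e0]
    ext x j
    have e4 : (ρ s * U.submatrix id (Subtype.val : {i // q i} → ι)) x j = (ρ s * U) x j.1 := by
      simp [Matrix.mul_apply]
    rw [e4, e, Matrix.mul_apply, Matrix.mul_apply]
    simp only [submatrix_apply, id]
    rw [← Fintype.sum_subtype_add_sum_subtype q]
    rw [add_eq_left]
    apply Finset.sum_eq_zero
    intro i _
    rw [hblk s _ _ (fun hd => i.2 (hq _ _ j.2 hd)), mul_zero]
  refine ⟨fun i => D i = D i0, inferInstance, U.submatrix id Subtype.val,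
    U.submatrix id Subtype.val, ⟨i0, rfl⟩, ⟨j0, fun h => hij h.symm⟩, ?_, ?_, ?_, ?_, ?_, ?_, ?_⟩
  · ext i j
    have := congrFun (congrFun hU1 i.1) j.1
    simpa [Matrix.mul_apply, Matrix.one_apply, Subtype.ext_iff] using this
  · ext i j
    have := congrFun (congrFun hU1 i.1) j.1
    simpa [Matrix.mul_apply, Matrix.one_apply, Subtype.ext_iff] using this
  · ext i j
    have := congrFun (congrFun hU1 i.1) j.1
    rw [Matrix.one_apply_ne (fun h => j.2 (by have := i.2; rwa [h] at this))] at this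
    simpa [Matrix.mul_apply] using this
  · ext i j
    have := congrFun (congrFun hU1 i.1) j.1
    rw [Matrix.one_apply_ne (fun h => i.2 (by have := j.2; rwa [← h] at this))] at this
    simpa [Matrix.mul_apply] using this
  · rw [← hU2]
    ext x y
    simp only [Matrix.add_apply, Matrix.mul_apply, submatrix_apply, conjTranspose_apply, id]
    exact Fintype.sum_subtype_add_sum_subtype (fun i => D i = D i0)
      (fun i => U x i * star (U y i))
  · exact key (fun i => D i = D i0) (fun i j hi hj => hj.trans hi)
  · exact key (fun i => ¬ D i = D i0) (fun i j hi hj h => hi (hj.symm.trans h))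

lemma bv_decomp (n : ℕ) : ∀ {S ι : Type} [Fintype ι] [DecidableEq ι] (_ : Fintype.card ι = n)
    (ρ : S → Matrix ι ι ℂ) (τ : S → S) (_ : ∀ s, ρ (τ s) = (ρ s)ᴴ),
    ∃ (I : Type) (_ : Fintype I) (_ : DecidableEq I) (d : I → ℕ)
      (w : ∀ i, Matrix ι (Fin (d i)) ℂ),
      (∀ i, 1 ≤ d i) ∧ (∀ i, (w i)ᴴ * w i = 1) ∧ (∀ i k, i ≠ k → (w i)ᴴ * w k = 0) ∧
      (∑ i, w i * (w i)ᴴ) = 1 ∧ (∀ i s, ρ s * w i = w i * ((w i)ᴴ * ρ s * w i)) ∧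
      (∀ i, BVIrr (fun s => (w i)ᴴ * ρ s * w i)) := by
  induction n using Nat.strong_induction_on with
  | _ n ih =>
  intro S ι _ _ hn ρ τ hτ
  by_cases hirr : BVIrr ρ
  · rcases isEmpty_or_nonempty ι with hι | hι
    · refine ⟨Empty, inferInstance, inferInstance, fun _ => 0, fun i => i.elim, ?_, ?_, ?_, ?_, ?_, ?_⟩
      · intro i; exact i.elim
      · intro i; exact i.elim
      · intro i; exact i.elim
      · exact Subsingleton.elim _ _
      · intro i; exact i.elim
      · intro i; exact i.elim
    · let e : ι ≃ Fin (Fintype.card ι) := Fintype.equivFin ι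
      let w : Matrix ι (Fin (Fintype.card ι)) ℂ := (1 : Matrix ι ι ℂ).submatrix id e.symm
      have h1 : wᴴ * w = 1 := by
        ext i j
        simp [w, Matrix.mul_apply, Matrix.one_apply]
      have h2 : w * wᴴ = 1 := by
        rw [Matrix.mul_eq_one_comm_of_equiv e]; exact h1
      refine ⟨Unit, inferInstance, inferInstance, fun _ => Fintype.card ι, fun _ => w,
        fun _ => Fintype.card_pos, fun _ => h1, ?_, ?_, ?_, ?_⟩
      · intro i k h; exact absurd (Subsingleton.elim _ _) h
      · simpa using h2
      · intro _ s
        rw [← Matrix.mul_assoc, ← Matrix.mul_assoc, h2, Matrix.one_mul]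
      · intro _ X hX
        obtain ⟨c, hc⟩ := hirr (w * X * wᴴ) (by
          intro s
          have h := hX s
          have h' := congrArg (fun M => w * M * wᴴ) h
          simp only at h'
          calc ρ s * (w * X * wᴴ) = (w * wᴴ) * ρ s * w * X * wᴴ := by
                rw [h2, Matrix.one_mul]; simp only [Matrix.mul_assoc]
            _ = w * (wᴴ * ρ s * w * X) * wᴴ := by simp only [Matrix.mul_assoc]
            _ = w * X * wᴴ * ρ s * (w * wᴴ) := by rw [h']; simp only [Matrix.mul_assoc]
            _ = _ := by rw [h2, Matrix.mul_one])
        refine ⟨c, ?_⟩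
        calc X = (wᴴ * w) * X * (wᴴ * w) := by rw [h1, Matrix.one_mul, Matrix.mul_one]
          _ = wᴴ * (w * X * wᴴ) * w := by simp only [Matrix.mul_assoc]
          _ = _ := by rw [hc, Matrix.mul_smul, Matrix.smul_mul, Matrix.mul_one, h1]
  · obtain ⟨p, _, v, w, ⟨i0, hi0⟩, ⟨j0, hj0⟩, hv, hw, hvw, hwv, hsum, hρv, hρw⟩ :=
      bv_split ρ τ hτ hirr
    have c1 : Fintype.card {i // p i} < n := hn ▸ Fintype.card_subtype_lt (x := j0) hj0
    have c2 : Fintype.card {i // ¬ p i} < n :=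
      hn ▸ Fintype.card_subtype_lt (x := i0) (not_not.2 hi0)
    obtain ⟨I, _, _, d, x, hd, hx1, hx2, hx3, hx4, hx5⟩ :=
      ih _ c1 rfl (fun s => vᴴ * ρ s * v) τ (by
        intro s; simp [hτ, conjTranspose_mul, Matrix.mul_assoc])
    obtain ⟨I', _, _, d', x', hd', hx1', hx2', hx3', hx4', hx5'⟩ :=
      ih _ c2 rfl (fun s => wᴴ * ρ s * w) τ (by
        intro s; simp [hτ, conjTranspose_mul, Matrix.mul_assoc])
    let dd : I ⊕ I' → ℕ := Sum.elim d d'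
    let ww : ∀ i : I ⊕ I', Matrix ι (Fin (dd i)) ℂ := fun i =>
      match i with
      | Sum.inl i => v * x i
      | Sum.inr i => w * x' i
    have l1 : ∀ {a b : Type} [Fintype a] [Fintype b] (M : Matrix {i // p i} a ℂ)
        (N : Matrix {i // p i} b ℂ), (v * M)ᴴ * (v * N) = Mᴴ * N := by
      intro a b _ _ M N
      rw [conjTranspose_mul, Matrix.mul_assoc, ← Matrix.mul_assoc vᴴ, hv, Matrix.one_mul]
    have l2 : ∀ {a b : Type} [Fintype a] [Fintype b] (M : Matrix {i // ¬ p i} a ℂ)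
        (N : Matrix {i // ¬ p i} b ℂ), (w * M)ᴴ * (w * N) = Mᴴ * N := by
      intro a b _ _ M N
      rw [conjTranspose_mul, Matrix.mul_assoc, ← Matrix.mul_assoc wᴴ, hw, Matrix.one_mul]
    refine ⟨I ⊕ I', inferInstance, inferInstance, dd, ww, ?_, ?_, ?_, ?_, ?_, ?_⟩
    · rintro (i | i)
      · exact hd i
      · exact hd' i
    · rintro (i | i)
      · exact (l1 _ _).trans (hx1 i)
      · exact (l2 _ _).trans (hx1' i)
    · rintro (i | i) (k | k) hik
      · exact (l1 _ _).trans (hx2 i k (fun h => hik (h ▸ rfl)))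
      · change (v * x i)ᴴ * (w * x' k) = 0
        rw [conjTranspose_mul, Matrix.mul_assoc, ← Matrix.mul_assoc vᴴ, hvw, Matrix.zero_mul,
          Matrix.mul_zero]
      · change (w * x' i)ᴴ * (v * x k) = 0
        rw [conjTranspose_mul, Matrix.mul_assoc, ← Matrix.mul_assoc wᴴ, hwv, Matrix.zero_mul,
          Matrix.mul_zero]
      · exact (l2 _ _).trans (hx2' i k (fun h => hik (h ▸ rfl)))
    · rw [Fintype.sum_sum_type]
      change ∑ i, (v * x i) * (v * x i)ᴴ + ∑ i, (w * x' i) * (w * x' i)ᴴ = 1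
      have e1 : ∑ i, (v * x i) * (v * x i)ᴴ = v * (∑ i, x i * (x i)ᴴ) * vᴴ := by
        rw [Matrix.mul_sum, Matrix.sum_mul]
        simp only [conjTranspose_mul, Matrix.mul_assoc]
      have e2 : ∑ i, (w * x' i) * (w * x' i)ᴴ = w * (∑ i, x' i * (x' i)ᴴ) * wᴴ := by
        rw [Matrix.mul_sum, Matrix.sum_mul]
        simp only [conjTranspose_mul, Matrix.mul_assoc]
      rw [e1, e2, hx3, hx3', Matrix.mul_one, Matrix.mul_one, hsum]
    · rintro (i | i) s
      · change ρ s * (v * x i) = (v * x i) * ((v * x i)ᴴ * ρ s * (v * x i))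
        have := hx4 i s
        rw [← Matrix.mul_assoc, hρv, Matrix.mul_assoc, this]
        simp only [conjTranspose_mul, Matrix.mul_assoc]
      · change ρ s * (w * x' i) = (w * x' i) * ((w * x' i)ᴴ * ρ s * (w * x' i))
        have := hx4' i s
        rw [← Matrix.mul_assoc, hρw, Matrix.mul_assoc, this]
        simp only [conjTranspose_mul, Matrix.mul_assoc]
    · rintro (i | i)
      · have := hx5 i
        change BVIrr (fun s => (v * x i)ᴴ * ρ s * (v * x i))
        simpa only [conjTranspose_mul, Matrix.mul_assoc] using this
      · have := hx5' i
        change BVIrr (fun s => (w * x' i)ᴴ * ρ s * (w * x' i))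
        simpa only [conjTranspose_mul, Matrix.mul_assoc] using this

lemma bv_schur_s2 {S ι κ : Type} [Fintype ι] [DecidableEq ι] [Fintype κ] [DecidableEq κ]
    (ρ : S → Matrix ι ι ℂ) (σ : S → Matrix κ κ ℂ) (τ : S → S)
    (hρ : ∀ s, ρ (τ s) = (ρ s)ᴴ) (hσ : ∀ s, σ (τ s) = (σ s)ᴴ)
    (iρ : BVIrr ρ) (iσ : BVIrr σ) (X : Matrix ι κ ℂ) (hX : ∀ s, ρ s * X = X * σ s)
    (h0 : X ≠ 0) :
    ∃ U : Matrix ι κ ℂ, Uᴴ * U = 1 ∧ U * Uᴴ = 1 ∧ ∀ s, ρ s * U = U * σ s := by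
  have hX' : ∀ s, σ s * Xᴴ = Xᴴ * ρ s := by
    intro s
    have := congrArg conjTranspose (hX (τ s))
    rw [conjTranspose_mul, conjTranspose_mul, hρ, hσ, conjTranspose_conjTranspose,
      conjTranspose_conjTranspose] at this
    exact this.symm
  obtain ⟨c, hc⟩ := iσ (Xᴴ * X) (by
    intro s; rw [← Matrix.mul_assoc, hX', Matrix.mul_assoc, hX, Matrix.mul_assoc])
  obtain ⟨c', hc'⟩ := iρ (X * Xᴴ) (by
    intro s; rw [← Matrix.mul_assoc, hX, Matrix.mul_assoc, hX', Matrix.mul_assoc])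
  have hcc : c = c' := by
    have e : c • X = c' • X := by
      calc c • X = X * (Xᴴ * X) := by rw [hc, Matrix.mul_smul, Matrix.mul_one]
        _ = (X * Xᴴ) * X := by rw [Matrix.mul_assoc]
        _ = _ := by rw [hc', Matrix.smul_mul, Matrix.one_mul]
    exact smul_left_injective ℂ h0 e
  subst hcc
  -- c is a positive real
  obtain ⟨r, hr, hrc⟩ : ∃ r : ℝ, 0 < r ∧ (r : ℂ) = c := by
    obtain ⟨i, k, hik⟩ : ∃ i k, X i k ≠ 0 := by
      by_contra hcon
      push Not at hcon
      exact h0 (by ext i k; exact hcon i k)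
    have e := congrFun (congrFun hc k) k
    rw [Matrix.smul_apply, Matrix.one_apply_eq, smul_eq_mul, mul_one, Matrix.mul_apply] at e
    refine ⟨∑ j, Complex.normSq (X j k), ?_, ?_⟩
    · exact Finset.sum_pos' (fun _ _ => Complex.normSq_nonneg _)
        ⟨i, Finset.mem_univ _, Complex.normSq_pos.2 hik⟩
    · rw [← e]
      push_cast
      refine Finset.sum_congr rfl fun j _ => ?_
      rw [Complex.normSq_eq_conj_mul_self]
      rfl
  have hs : ((Real.sqrt r : ℂ))⁻¹ * ((Real.sqrt r : ℂ))⁻¹ * c = 1 := by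
    rw [← hrc, ← mul_inv, ← Complex.ofReal_mul, Real.mul_self_sqrt hr.le]
    exact inv_mul_cancel₀ (by exact_mod_cast hr.ne')
  have hst : star ((Real.sqrt r : ℂ))⁻¹ = ((Real.sqrt r : ℂ))⁻¹ := by
    simp
  refine ⟨((Real.sqrt r : ℂ))⁻¹ • X, ?_, ?_, ?_⟩
  · rw [conjTranspose_smul, hst, Matrix.smul_mul, Matrix.mul_smul, hc, smul_smul, smul_smul, hs,
      one_smul]
  · rw [conjTranspose_smul, hst, Matrix.smul_mul, Matrix.mul_smul, hc', smul_smul, smul_smul, hs,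
      one_smul]
  · intro s
    rw [Matrix.mul_smul, Matrix.smul_mul, hX]

lemma bv_grouped {S ι : Type} [Fintype ι] [DecidableEq ι]
    (ρ : S → Matrix ι ι ℂ) (τ : S → S) (hτ : ∀ s, ρ (τ s) = (ρ s)ᴴ) :
    ∃ (N : ℕ) (a b : Fin N → ℕ) (v : ∀ α, Fin (b α) → Matrix ι (Fin (a α)) ℂ)
      (σ : ∀ α, S → Matrix (Fin (a α)) (Fin (a α)) ℂ),
      (∀ α, 1 ≤ a α ∧ 1 ≤ b α) ∧
      (∀ α k, (v α k)ᴴ * v α k = 1) ∧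
      (∀ α k l, k ≠ l → (v α k)ᴴ * v α l = 0) ∧
      (∀ α β k l, α ≠ β → (v α k)ᴴ * v β l = 0) ∧
      (∑ α, ∑ k, v α k * (v α k)ᴴ) = 1 ∧
      (∀ α k s, ρ s * v α k = v α k * σ α s) ∧
      (∀ α k s, (v α k)ᴴ * ρ s = σ α s * (v α k)ᴴ) ∧
      (∀ α, BVIrr (σ α)) ∧
      (∀ α β, α ≠ β → ∀ X : Matrix (Fin (a α)) (Fin (a β)) ℂ,
        (∀ s, σ α s * X = X * σ β s) → X = 0) := by
  classical
  obtain ⟨I, _, _, d, w, hd, hw1, hw2, hw3, hw4, hw5⟩ := bv_decomp _ rfl ρ τ hτ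
  let r : ∀ i, S → Matrix (Fin (d i)) (Fin (d i)) ℂ := fun i s => (w i)ᴴ * ρ s * w i
  have hr : ∀ i s, r i (τ s) = (r i s)ᴴ := by
    intro i s; simp [r, hτ, conjTranspose_mul, Matrix.mul_assoc]
  let st : Setoid I :=
    { r := fun i k => ∃ U : Matrix (Fin (d i)) (Fin (d k)) ℂ,
        Uᴴ * U = 1 ∧ U * Uᴴ = 1 ∧ ∀ s, r i s * U = U * r k s
      iseqv :=
        { refl := fun i => ⟨1, by simp, by simp, by simp⟩
          symm := by
            rintro i k ⟨U, h1, h2, h3⟩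
            refine ⟨Uᴴ, by simpa using h2, by simpa using h1, fun s => ?_⟩
            have := congrArg conjTranspose (h3 (τ s))
            rw [hr, hr, conjTranspose_mul (r i s)ᴴ U, conjTranspose_mul U (r k s)ᴴ,
              conjTranspose_conjTranspose, conjTranspose_conjTranspose] at this
            exact this.symm
          trans := by
            rintro i k l ⟨U, h1, h2, h3⟩ ⟨V, g1, g2, g3⟩
            refine ⟨U * V, ?_, ?_, fun s => ?_⟩
            · rw [conjTranspose_mul, Matrix.mul_assoc, ← Matrix.mul_assoc Uᴴ, h1, Matrix.one_mul, g1]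
            · rw [conjTranspose_mul, Matrix.mul_assoc, ← Matrix.mul_assoc V, g2, Matrix.one_mul, h2]
            · rw [← Matrix.mul_assoc, h3, Matrix.mul_assoc, g3, Matrix.mul_assoc] } }
  let Q := Quotient st
  have hex : ∀ (q : Q) (i : {i : I // (Quotient.mk st i) = q}),
      ∃ U : Matrix (Fin (d i.1)) (Fin (d q.out)) ℂ,
        Uᴴ * U = 1 ∧ U * Uᴴ = 1 ∧ ∀ s, r i.1 s * U = U * r q.out s := by
    rintro q ⟨i, hi⟩
    have : (Quotient.mk st i) = Quotient.mk st q.out := by rw [hi, Quotient.out_eq]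
    exact Quotient.exact this
  choose u hu1 hu2 hu3 using hex
  let eQ : Q ≃ Fin (Fintype.card Q) := Fintype.equivFin Q
  let eI : ∀ q : Q, {i : I // (Quotient.mk st i) = q} ≃
      Fin (Fintype.card {i : I // (Quotient.mk st i) = q}) := fun q => Fintype.equivFin _
  let v : ∀ (q : Q) (i : {i : I // (Quotient.mk st i) = q}), Matrix ι (Fin (d q.out)) ℂ :=
    fun q i => w i.1 * u q i
  have hv0 : ∀ q i q' i', i.1 ≠ i'.1 → (v q i)ᴴ * v q' i' = 0 := by
    intro q i q' i' h
    simp only [v]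
    rw [conjTranspose_mul, Matrix.mul_assoc, ← Matrix.mul_assoc (w i.1)ᴴ, hw2 _ _ h,
      Matrix.zero_mul, Matrix.mul_zero]
  have hρv : ∀ q i s, ρ s * v q i = v q i * r q.out s := by
    intro q i s
    simp only [v]
    rw [← Matrix.mul_assoc, hw4, Matrix.mul_assoc, Matrix.mul_assoc (w i.1) (u q i), ← hu3]
  refine ⟨Fintype.card Q, fun α => d (eQ.symm α).out, fun α => Fintype.card _,
    fun α k => v (eQ.symm α) ((eI _).symm k), fun α => r (eQ.symm α).out, ?_, ?_, ?_, ?_, ?_, ?_,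
    ?_, ?_, ?_⟩
  · intro α
    refine ⟨hd _, Fintype.card_pos_iff.2 ⟨⟨(eQ.symm α).out, Quotient.out_eq _⟩⟩⟩
  · intro α k
    simp only [v]
    rw [conjTranspose_mul, Matrix.mul_assoc, ← Matrix.mul_assoc (w _)ᴴ, hw1,
      Matrix.one_mul, hu1]
  · intro α k l hkl
    apply hv0
    intro h
    exact hkl ((eI _).symm.injective (Subtype.ext h))
  · intro α β k l hαβ
    apply hv0
    intro h
    apply hαβ
    apply eQ.symm.injective
    rw [← ((eI _).symm k).2, ← ((eI _).symm l).2, h]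
  · have e1 : ∀ q : Q, ∑ k, v q ((eI q).symm k) * (v q ((eI q).symm k))ᴴ =
        ∑ i : {i : I // (Quotient.mk st i) = q}, w i.1 * (w i.1)ᴴ := by
      intro q
      rw [Equiv.sum_comp (eI q).symm (fun i => v q i * (v q i)ᴴ)]
      refine Finset.sum_congr rfl fun i _ => ?_
      simp only [v]
      rw [conjTranspose_mul, Matrix.mul_assoc, ← Matrix.mul_assoc (u q i), hu2, Matrix.one_mul]
    rw [Equiv.sum_comp eQ.symm (fun q => ∑ k, v q ((eI q).symm k) * (v q ((eI q).symm k))ᴴ)]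
    simp only [e1]
    rw [← hw3, Fintype.sum_fiberwise (fun i => Quotient.mk st i) (fun i => w i * (w i)ᴴ)]
  · intro α k s
    exact hρv _ _ _
  · intro α k s
    have := congrArg conjTranspose (hρv _ ((eI (eQ.symm α)).symm k) (τ s))
    rw [hτ, hr, conjTranspose_mul (ρ s)ᴴ (v _ _), conjTranspose_mul (v _ _) (r _ s)ᴴ,
      conjTranspose_conjTranspose, conjTranspose_conjTranspose] at this
    exact this
  · intro α
    exact hw5 _
  · intro α β hαβ X hX
    by_contra h0
    apply hαβ
    apply eQ.symm.injective
    have : st.r (eQ.symm α).out (eQ.symm β).out :=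
      bv_schur_s2 _ _ τ (hr _) (hr _) (hw5 _) (hw5 _) X hX h0
    rw [← Quotient.out_eq (eQ.symm α), ← Quotient.out_eq (eQ.symm β)]
    exact Quotient.sound this

lemma bv_core {S ι : Type} [Fintype ι] [DecidableEq ι]
    (ρ : S → Matrix ι ι ℂ) (τ : S → S) (hτ : ∀ s, ρ (τ s) = (ρ s)ᴴ) :
    ∃ (N : ℕ) (a b : Fin N → ℕ) (W : ∀ α, Matrix ι (Fin (a α) × Fin (b α)) ℂ),
      (∀ α, 1 ≤ a α ∧ 1 ≤ b α) ∧
      (∀ α, (W α)ᴴ * W α = 1) ∧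
      (∀ α β, α ≠ β → (W α)ᴴ * W β = 0) ∧
      (∑ α, W α * (W α)ᴴ) = 1 ∧
      (∀ α s, Commute (ρ s) (W α * (W α)ᴴ)) ∧
      (∀ α t, (∀ s, ρ s * t = t * ρ s) → Commute t (W α * (W α)ᴴ)) ∧
      (∀ α s, ∃ x : Matrix (Fin (a α)) (Fin (a α)) ℂ,
        (W α)ᴴ * ρ s * W α = x ⊗ₖ (1 : Matrix (Fin (b α)) (Fin (b α)) ℂ)) ∧
      (∀ α t, (∀ s, ρ s * t = t * ρ s) → ∃ y : Matrix (Fin (b α)) (Fin (b α)) ℂ,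
        (W α)ᴴ * t * W α = (1 : Matrix (Fin (a α)) (Fin (a α)) ℂ) ⊗ₖ y) := by
  obtain ⟨N, a, b, v, σ, hab, h1, h2, h3, h4, h5, h6, h7, h8⟩ := bv_grouped ρ τ hτ
  let W : ∀ α, Matrix ι (Fin (a α) × Fin (b α)) ℂ := fun α => Matrix.of fun x p => v α p.2 x p.1
  have hW : ∀ α β (M : Matrix ι ι ℂ) p q,
      ((W α)ᴴ * M * W β) p q = ((v α p.2)ᴴ * M * v β q.2) p.1 q.1 := by
    intro α β M p q
    simp [Matrix.mul_apply, W]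
  have hW1 : ∀ α β p q, ((W α)ᴴ * W β) p q = ((v α p.2)ᴴ * v β q.2) p.1 q.1 := by
    intro α β p q
    simp [Matrix.mul_apply, W]
  have hWW : ∀ α, W α * (W α)ᴴ = ∑ k, v α k * (v α k)ᴴ := by
    intro α
    ext x y
    rw [Matrix.sum_apply, Matrix.mul_apply, Fintype.sum_prod_type_right]
    simp [Matrix.mul_apply, W]
  have hint : ∀ t, (∀ s, ρ s * t = t * ρ s) → ∀ α β k l s,
      σ α s * ((v α k)ᴴ * t * v β l) = ((v α k)ᴴ * t * v β l) * σ β s := by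
    intro t ht α β k l s
    calc σ α s * ((v α k)ᴴ * t * v β l) = (σ α s * (v α k)ᴴ) * t * v β l := by
          simp only [Matrix.mul_assoc]
      _ = (v α k)ᴴ * (ρ s * t) * v β l := by rw [← h6]; simp only [Matrix.mul_assoc]
      _ = (v α k)ᴴ * t * (ρ s * v β l) := by rw [ht]; simp only [Matrix.mul_assoc]
      _ = _ := by rw [h5]; simp only [Matrix.mul_assoc]
  have hiso : ∀ α, (W α)ᴴ * W α = 1 := by
    intro α
    ext ⟨p, k⟩ ⟨q, l⟩
    rw [hW1]
    by_cases hkl : k = l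
    · subst hkl
      simp [h1, Matrix.one_apply]
    · simp [h2 _ _ _ hkl, Matrix.one_apply, hkl]
  have hsum : (∑ α, W α * (W α)ᴴ) = 1 := by
    simp only [hWW]; exact h4
  refine ⟨N, a, b, W, hab, hiso, ?_, hsum, ?_, ?_, ?_, ?_⟩
  · intro α β hαβ
    ext p q
    rw [hW1, h3 _ _ _ _ hαβ]; rfl
  · intro α s
    rw [hWW]
    refine Commute.sum_right _ _ _ fun k _ => ?_
    change ρ s * (v α k * (v α k)ᴴ) = (v α k * (v α k)ᴴ) * ρ s
    rw [← Matrix.mul_assoc, h5, Matrix.mul_assoc, ← h6, Matrix.mul_assoc]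
  · intro α t ht
    have hz : ∀ β γ, β ≠ γ → (W β * (W β)ᴴ) * t * (W γ * (W γ)ᴴ) = 0 := by
      intro β γ hβγ
      have : (W β)ᴴ * t * W γ = 0 := by
        ext p q
        rw [hW, h8 β γ hβγ _ (hint t ht β γ _ _)]; rfl
      calc (W β * (W β)ᴴ) * t * (W γ * (W γ)ᴴ) = W β * ((W β)ᴴ * t * W γ) * (W γ)ᴴ := by
            simp only [Matrix.mul_assoc]
        _ = 0 := by rw [this, Matrix.mul_zero, Matrix.zero_mul]
    have e1 : t * (W α * (W α)ᴴ) = (W α * (W α)ᴴ) * t * (W α * (W α)ᴴ) := by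
      calc t * (W α * (W α)ᴴ) = (∑ β, W β * (W β)ᴴ) * (t * (W α * (W α)ᴴ)) := by
            rw [hsum, Matrix.one_mul]
        _ = ∑ β, (W β * (W β)ᴴ) * t * (W α * (W α)ᴴ) := by
            rw [Matrix.sum_mul]; simp only [Matrix.mul_assoc]
        _ = _ := Finset.sum_eq_single α (fun β _ h => hz β α h) (by simp)
    have e2 : (W α * (W α)ᴴ) * t = (W α * (W α)ᴴ) * t * (W α * (W α)ᴴ) := by
      calc (W α * (W α)ᴴ) * t = ((W α * (W α)ᴴ) * t) * (∑ β, W β * (W β)ᴴ) := by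
            rw [hsum, Matrix.mul_one]
        _ = ∑ β, (W α * (W α)ᴴ) * t * (W β * (W β)ᴴ) := by
            rw [Matrix.mul_sum]
        _ = _ := Finset.sum_eq_single α (fun β _ h => hz α β h.symm) (by simp)
    exact e1.trans e2.symm
  · intro α s
    refine ⟨σ α s, ?_⟩
    ext ⟨p, k⟩ ⟨q, l⟩
    rw [hW, Matrix.mul_assoc, h5, ← Matrix.mul_assoc, kroneckerMap_apply]
    by_cases hkl : k = l
    · subst hkl
      simp [h1]
    · simp [h2 _ _ _ hkl, hkl]
  · intro α t ht
    have : ∀ k l, ∃ c : ℂ, (v α k)ᴴ * t * v α l = c • (1 : Matrix (Fin (a α)) (Fin (a α)) ℂ) :=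
      fun k l => h7 α _ (hint t ht α α k l)
    choose c hc using this
    refine ⟨Matrix.of c, ?_⟩
    ext ⟨p, k⟩ ⟨q, l⟩
    rw [hW, hc, kroneckerMap_apply]
    simp [mul_comm]

lemma bv_card {n a b : ℕ} (W : Matrix (Fin n) (Fin a × Fin b) ℂ) (h : Wᴴ * W = 1) :
    a * b ≤ n := by
  have h1 : (Wᴴ * W).rank = a * b := by rw [h, Matrix.rank_one]; simp
  have h2 : (Wᴴ * W).rank ≤ n :=
    (Matrix.rank_mul_le_right _ _).trans ((Matrix.rank_le_card_height W).trans (by simp))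
  omega

lemma bv_scalar_s2 {n a b : ℕ} (W : Matrix (Fin n) (Fin a × Fin b) ℂ) (h : Wᴴ * W = 1)
    (hab : a * b = n) (M : Matrix (Fin n) (Fin n) ℂ) (c : ℂ) (hM : Wᴴ * M * W = c • 1) :
    M = c • 1 := by
  have h' : W * Wᴴ = 1 := by
    exact (Matrix.mul_eq_one_comm_of_card_eq _ _ _ (by simp [hab])).1 h
  calc M = (W * Wᴴ) * M * (W * Wᴴ) := by rw [h', Matrix.one_mul, Matrix.mul_one]
    _ = W * (Wᴴ * M * W) * Wᴴ := by simp only [Matrix.mul_assoc]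
    _ = _ := by rw [hM, Matrix.mul_smul, Matrix.smul_mul, Matrix.mul_one, h']

lemma bv_one_by_one {m : ℕ} (hm : m = 1) (x : Matrix (Fin m) (Fin m) ℂ) :
    ∃ c : ℂ, x = c • 1 := by
  subst hm
  refine ⟨x 0 0, ?_⟩
  ext i j
  rw [Subsingleton.elim i 0, Subsingleton.elim j 0]
  simp


/-- corollary of the Bravyi–Vyalyi structure lemma, for an isolated term.
Model the nonzero finite-dimensional complex inner product spaces `H₁, H₂` and `K_j`
(`j ∈ J`, `J` finite) as `ℂ^(Fin n₁)`, `ℂ^(Fin n₂)`, `ℂ^(Fin (κ j))`, a self-adjoint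
operator `A` on `H₁ ⊗ H₂` as a Hermitian matrix indexed by `Fin n₁ × Fin n₂`, and
self-adjoint operators `B j` on `H₂ ⊗ K_j`; assume each `A ⊗ I_{K_j}` commutes with
`I_{H₁} ⊗ B j` on `H₁ ⊗ H₂ ⊗ K_j`. Then `H₂` decomposes into pairwise orthogonal
nonzero subspaces `V_α` (ranges of isometries `W α` summing to the identity) with
unitary identifications `V_α ≅ V_α⁰ ⊗ V_α¹` (`V_α⁰ = ℂ^(Fin (a α))`,
`V_α¹ = ℂ^(Fin (b α))`, both nonzero), such that (i) `A` preserves each `H₁ ⊗ V_α`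
and each `B j` preserves each `V_α ⊗ K_j`; (ii) on `H₁ ⊗ V_α`, `A` acts as
`a_α ⊗ I_{V_α¹}`; (iii) on `V_α ⊗ K_j`, `B j` acts as `I_{V_α⁰} ⊗ b_{j,α}`.
Moreover, if `dim H₂ ≥ 2`, `A` is not of the form `a ⊗ I`, and some `B j` is not of
the form `I ⊗ b`, then the decomposition can be chosen with `dim V_α⁰ < dim H₂` and
`dim V_α¹ < dim H₂` for every `α`. -/
theorem stmt_2 (n₁ n₂ : ℕ) (h1 : 1 ≤ n₁) (h2 : 1 ≤ n₂)
    (J : Type) [Fintype J] (κ : J → ℕ) (hκ : ∀ j, 1 ≤ κ j)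
    (A : Matrix (Fin n₁ × Fin n₂) (Fin n₁ × Fin n₂) ℂ) (hA : A.IsHermitian)
    (B : (j : J) → Matrix (Fin n₂ × Fin (κ j)) (Fin n₂ × Fin (κ j)) ℂ)
    (hB : ∀ j, (B j).IsHermitian)
    (hcomm : ∀ j, Commute
      (Matrix.reindex (Equiv.prodAssoc (Fin n₁) (Fin n₂) (Fin (κ j)))
        (Equiv.prodAssoc (Fin n₁) (Fin n₂) (Fin (κ j)))
        (A ⊗ₖ (1 : Matrix (Fin (κ j)) (Fin (κ j)) ℂ)))
      ((1 : Matrix (Fin n₁) (Fin n₁) ℂ) ⊗ₖ B j)) :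
    ∃ (N : ℕ) (a b : Fin N → ℕ)
      (W : (α : Fin N) → Matrix (Fin n₂) (Fin (a α) × Fin (b α)) ℂ),
      -- the subspaces V_α and the tensor factors V_α⁰, V_α¹ are nonzero
      (∀ α, 1 ≤ a α ∧ 1 ≤ b α) ∧
      -- W α is an isometry of V_α⁰ ⊗ V_α¹ onto the subspace V_α ⊆ H₂
      (∀ α, (W α)ᴴ * W α = 1) ∧
      -- the subspaces V_α are pairwise orthogonal
      (∀ α β, α ≠ β → (W α)ᴴ * W β = 0) ∧
      -- the direct sum of the V_α is all of H₂
      (∑ α, W α * (W α)ᴴ) = 1 ∧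
      -- (i): A maps H₁ ⊗ V_α into itself and every B j maps V_α ⊗ K_j into itself
      (∀ α, Commute A ((1 : Matrix (Fin n₁) (Fin n₁) ℂ) ⊗ₖ (W α * (W α)ᴴ))) ∧
      (∀ α j, Commute (B j)
        ((W α * (W α)ᴴ) ⊗ₖ (1 : Matrix (Fin (κ j)) (Fin (κ j)) ℂ))) ∧
      -- (ii): on H₁ ⊗ V_α, A acts as a_α ⊗ I_{V_α¹}
      (∀ α, ∃ aop : Matrix (Fin n₁ × Fin (a α)) (Fin n₁ × Fin (a α)) ℂ,
        ((1 : Matrix (Fin n₁) (Fin n₁) ℂ) ⊗ₖ W α)ᴴ * A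
            * ((1 : Matrix (Fin n₁) (Fin n₁) ℂ) ⊗ₖ W α)
          = Matrix.reindex (Equiv.prodAssoc (Fin n₁) (Fin (a α)) (Fin (b α)))
              (Equiv.prodAssoc (Fin n₁) (Fin (a α)) (Fin (b α)))
              (aop ⊗ₖ (1 : Matrix (Fin (b α)) (Fin (b α)) ℂ))) ∧
      -- (iii): on V_α ⊗ K_j, B j acts as I_{V_α⁰} ⊗ b_{j,α}
      (∀ α j, ∃ bop : Matrix (Fin (b α) × Fin (κ j)) (Fin (b α) × Fin (κ j)) ℂ,
        (W α ⊗ₖ (1 : Matrix (Fin (κ j)) (Fin (κ j)) ℂ))ᴴ * B j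
            * (W α ⊗ₖ (1 : Matrix (Fin (κ j)) (Fin (κ j)) ℂ))
          = Matrix.reindex (Equiv.prodAssoc (Fin (a α)) (Fin (b α)) (Fin (κ j))).symm
              (Equiv.prodAssoc (Fin (a α)) (Fin (b α)) (Fin (κ j))).symm
              ((1 : Matrix (Fin (a α)) (Fin (a α)) ℂ) ⊗ₖ bop)) ∧
      -- moreover: if dim H₂ ≥ 2, A is not of the form a ⊗ I, and some B j is not of
      -- the form I ⊗ b, the decomposition can be chosen with
      -- dim V_α⁰ < dim H₂ and dim V_α¹ < dim H₂
      (2 ≤ n₂ →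
       (¬ ∃ a0 : Matrix (Fin n₁) (Fin n₁) ℂ,
          A = a0 ⊗ₖ (1 : Matrix (Fin n₂) (Fin n₂) ℂ)) →
       (∃ j, ¬ ∃ b0 : Matrix (Fin (κ j)) (Fin (κ j)) ℂ,
          B j = (1 : Matrix (Fin n₂) (Fin n₂) ℂ) ⊗ₖ b0) →
       ∀ α, a α < n₂ ∧ b α < n₂) := by
  classical
  let ρ : Fin n₁ × Fin n₁ → Matrix (Fin n₂) (Fin n₂) ℂ :=
    fun s => Matrix.of fun x y => A (s.1, x) (s.2, y)
  let T : ∀ j, Fin (κ j) → Fin (κ j) → Matrix (Fin n₂) (Fin n₂) ℂ :=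
    fun j k l => Matrix.of fun x y => B j (x, k) (y, l)
  have hρ : ∀ s, ρ (Prod.swap s) = (ρ s)ᴴ := by
    rintro ⟨i, j⟩
    ext x y
    exact (hA.apply (j, x) (i, y)).symm
  have hT : ∀ j k l s, ρ s * T j k l = T j k l * ρ s := by
    rintro j k l ⟨p, q⟩
    ext x y
    have := congrFun (congrFun (hcomm j).eq (p, x, k)) (q, y, l)
    simp only [Matrix.mul_apply, Fintype.sum_prod_type, reindex_apply, submatrix_apply,
      kroneckerMap_apply, Equiv.prodAssoc_symm_apply, Matrix.one_apply] at this
    simp only [Matrix.mul_apply, ρ, T, Matrix.of_apply]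
    simpa [Finset.sum_ite_eq, ite_mul, mul_ite] using this
  obtain ⟨N, a, b, W, hab, hiso, horth, hsum, hcA, hcB, hAW, hBW⟩ := bv_core ρ Prod.swap hρ
  refine ⟨N, a, b, W, hab, hiso, horth, hsum, ?_, ?_, ?_, ?_, ?_⟩
  · intro α
    ext ⟨p, x⟩ ⟨q, y⟩
    have := congrFun (congrFun (hcA α (p, q)).eq x) y
    generalize W α * (W α)ᴴ = P at *
    simp only [Matrix.mul_apply, ρ, Matrix.of_apply] at this
    simp only [Matrix.mul_apply, Fintype.sum_prod_type, kroneckerMap_apply, Matrix.one_apply]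
    simpa [Finset.sum_ite_eq, ite_mul, mul_ite, Finset.sum_comm] using this
  · intro α j
    ext ⟨x, k⟩ ⟨y, l⟩
    have := congrFun (congrFun (hcB α (T j k l) (hT j k l)).eq x) y
    generalize W α * (W α)ᴴ = P at *
    simp only [Matrix.mul_apply, T, Matrix.of_apply] at this
    simp only [Matrix.mul_apply, Fintype.sum_prod_type, kroneckerMap_apply, Matrix.one_apply]
    simpa [Finset.sum_ite_eq, ite_mul, mul_ite] using this
  · intro α
    choose x hx using hAW α
    refine ⟨Matrix.of fun p q => x (p.1, q.1) p.2 q.2, ?_⟩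
    ext ⟨p, i, k⟩ ⟨q, i', k'⟩
    have := congrFun (congrFun (hx (p, q)) (i, k)) (i', k')
    rw [kroneckerMap_apply] at this
    simp only [reindex_apply, submatrix_apply, kroneckerMap_apply, Equiv.prodAssoc_symm_apply,
      Matrix.of_apply]
    rw [← this]
    simp only [Matrix.mul_apply, Fintype.sum_prod_type, kroneckerMap_apply, Matrix.one_apply,
      conjTranspose_apply, ρ, Matrix.of_apply]
    simp [Finset.sum_ite_eq, ite_mul, mul_ite, apply_ite]
  · intro α j
    choose y hy using fun k l => hBW α (T j k l) (hT j k l)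
    refine ⟨Matrix.of fun p q => y p.2 q.2 p.1 q.1, ?_⟩
    ext ⟨⟨i, k⟩, p⟩ ⟨⟨i', k'⟩, q⟩
    have := congrFun (congrFun (hy p q) (i, k)) (i', k')
    rw [kroneckerMap_apply] at this
    simp only [reindex_apply, submatrix_apply, kroneckerMap_apply, Equiv.symm_symm,
      Equiv.prodAssoc_apply, Matrix.of_apply]
    rw [← this]
    simp only [Matrix.mul_apply, Fintype.sum_prod_type, kroneckerMap_apply, Matrix.one_apply,
      conjTranspose_apply, T, Matrix.of_apply]
    simp [Finset.sum_ite_eq, ite_mul, mul_ite, apply_ite]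
  · intro hn hnA hnB α
    have hle := bv_card (W α) (hiso α)
    obtain ⟨ha, hb⟩ := hab α
    constructor
    · by_contra hcon
      obtain ⟨hb1, han⟩ : b α = 1 ∧ a α * b α = n₂ := by
        push Not at hcon
        have : b α = 1 := by nlinarith
        refine ⟨this, ?_⟩
        rw [this] at hle ⊢
        omega
      obtain ⟨j, hj⟩ := hnB
      apply hj
      have : ∀ k l, ∃ c : ℂ, T j k l = c • 1 := by
        intro k l
        obtain ⟨y, hy⟩ := hBW α (T j k l) (hT j k l)
        obtain ⟨c, hc⟩ := bv_one_by_one hb1 y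
        refine ⟨c, bv_scalar_s2 (W α) (hiso α) han _ c ?_⟩
        rw [hy, hc, kronecker_smul, one_kronecker_one]
      choose c hc using this
      refine ⟨Matrix.of c, ?_⟩
      ext ⟨x, k⟩ ⟨y, l⟩
      have := congrFun (congrFun (hc k l) x) y
      rw [kroneckerMap_apply]
      simpa [T, mul_comm] using this
    · by_contra hcon
      obtain ⟨ha1, han⟩ : a α = 1 ∧ a α * b α = n₂ := by
        push Not at hcon
        have : a α = 1 := by nlinarith
        refine ⟨this, ?_⟩
        rw [this] at hle ⊢
        omega
      apply hnA
      have : ∀ s, ∃ c : ℂ, ρ s = c • 1 := by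
        intro s
        obtain ⟨y, hy⟩ := hAW α s
        obtain ⟨c, hc⟩ := bv_one_by_one ha1 y
        refine ⟨c, bv_scalar_s2 (W α) (hiso α) han _ c ?_⟩
        rw [hy, hc, smul_kronecker, one_kronecker_one]
      choose c hc using this
      refine ⟨Matrix.of fun p q => c (p, q), ?_⟩
      ext ⟨p, x⟩ ⟨q, y⟩
      have := congrFun (congrFun (hc (p, q)) x) y
      rw [kroneckerMap_apply]
      simpa [ρ] using this
end
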